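/- arXiv:2009.10889 — 2 statements merged into one kernel-verified Lean document; each statement's English description precedes it below -/
import Mathlib

section
/- Let p be a prime, d ≥ 1, q = p^d, and n ≥ 1. Let K be an algebraically closed field with char K ≠ p. Let A and A' be finite commutative local rings of length two with residue field of cardinality q, i.e., their maximal ideals m ⊂ A and m' ⊂ A' satisfy m² = 0 and m'² = 0, |A/m| = |A'/m'| = q, and |A| = |A'| = q². Then there is a K-algebra isomorphism between the group algebras K[GL_n(A)] and K[GL_n(A')]. -/
open Matrix

open Polynomial in
lemma exists_basis_shift_of_isNilpotent {k V : Type*} [Field k] [AddCommGroup V] [Module k V]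
    [Module.Finite k V] (φ : V →ₗ[k] V) (hφ : IsNilpotent φ) :
    ∃ (d : ℕ) (m : Fin d → ℕ) (b : Module.Basis (Σ i, Fin (m i)) k V),
      ∀ i (j : Fin (m i)), φ (b ⟨i, j⟩) = if h : j.1 + 1 < m i then b ⟨i, ⟨j + 1, h⟩⟩ else 0 := by
  have htors : Module.IsTorsion' (Module.AEval' φ) (Submonoid.powers (X : k[X])) := by
    obtain ⟨N, hN⟩ := hφ
    intro v
    refine ⟨⟨X ^ N, N, rfl⟩, ?_⟩
    obtain ⟨v, rfl⟩ := (Module.AEval'.of φ).surjective v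
    change (X ^ N : k[X]) • (Module.AEval'.of φ v) = 0
    rw [Module.AEval'.X_pow_smul_of, hN]
    simp
  obtain ⟨d, m, ⟨e⟩⟩ := Module.torsion_by_prime_power_decomposition Polynomial.irreducible_X htors
  let pb i : PowerBasis k (AdjoinRoot (X ^ m i : k[X])) :=
    AdjoinRoot.powerBasis' (monic_X_pow (m i))
  have hdim i : (pb i).dim = m i := by simp [pb]
  let c i : Module.Basis (Fin (m i)) k (AdjoinRoot (X ^ m i : k[X])) :=
    (pb i).basis.reindex (finCongr (hdim i))
  have hc i j : c i j = AdjoinRoot.root (X ^ m i : k[X]) ^ (j : ℕ) := by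
    simp [c, pb]
  let e' : V ≃ₗ[k] Π₀ i, AdjoinRoot (X ^ m i : k[X]) :=
    (Module.AEval'.of φ).trans (e.restrictScalars k)
  have he' (v : V) i : e' (φ v) i = AdjoinRoot.root (X ^ m i : k[X]) * e' v i := by
    have h : e (Module.AEval'.of φ (φ v)) = (X : k[X]) • e (Module.AEval'.of φ v) := by
      rw [← map_smul, Module.AEval'.X_smul_of]
    exact congrArg (fun x => x i) h
  let b := (DFinsupp.basis c).map e'.symm
  have hb i j : e' (b ⟨i, j⟩) = DFinsupp.single i (AdjoinRoot.root (X ^ m i : k[X]) ^ (j : ℕ)) := by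
    simp only [b, Module.Basis.map_apply, LinearEquiv.apply_symm_apply]
    rw [← hc]
    apply (DFinsupp.basis c).repr.injective
    ext ⟨i', j'⟩
    simp [DFinsupp.basis]
  refine ⟨d, m, b, fun i j => e'.injective ?_⟩
  ext i'
  rw [he', hb]
  split_ifs with h
  · rw [hb]
    by_cases hi : i = i'
    · subst hi; simp [pow_succ']
    · simp [DFinsupp.single_eq_of_ne (Ne.symm hi)]
  · have : m i = j + 1 := by omega
    by_cases hi : i = i'
    · subst hi
      rw [map_zero, DFinsupp.zero_apply, DFinsupp.single_eq_same, ← pow_succ', ← this,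
        ← AdjoinRoot.mk_X, ← map_pow, AdjoinRoot.mk_self]
    · simp [DFinsupp.single_eq_of_ne (Ne.symm hi)]

lemma exists_pequiv_of_isNilpotent {k ι : Type*} [Field k] [Fintype ι] [DecidableEq ι]
    (N : Matrix ι ι k) (hN : IsNilpotent N) :
    ∃ (f : ι ≃. ι) (P : GL ι k), N * (P : Matrix ι ι k) = (P : Matrix ι ι k) * f.toMatrix := by
  obtain ⟨d, m, b, hb⟩ := exists_basis_shift_of_isNilpotent (Matrix.toLin' N)
    (hN.map (Matrix.toLinAlgEquiv' (R := k) (n := ι)))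
  let f : (Σ i, Fin (m i)) ≃. (Σ i, Fin (m i)) :=
    { toFun x := if 0 < x.2.1 then some ⟨x.1, ⟨x.2.1 - 1, by omega⟩⟩ else none
      invFun x := if h : x.2.1 + 1 < m x.1 then some ⟨x.1, ⟨x.2.1 + 1, h⟩⟩ else none
      inv := by
        rintro ⟨i, j⟩ ⟨i', j'⟩
        constructor
        · intro h
          simp only [] at h ⊢
          split_ifs at h with h1
          cases h
          simp
        · intro h
          simp only [] at h ⊢
          split_ifs at h with h1
          cases h
          have : j.1 - 1 + 1 = j.1 := Nat.sub_add_cancel h1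
          simp [this] }
  have hf x : Matrix.toLin' N (b x) = (f.symm x).elim 0 b := by
    obtain ⟨i, j⟩ := x
    rw [hb]
    change _ = Option.elim (if h : j.1 + 1 < m i then some (⟨i, ⟨j.1 + 1, h⟩⟩ : Σ i, Fin (m i))
      else none) 0 b
    split_ifs <;> rfl
  let σ : (Σ i, Fin (m i)) ≃ ι := b.indexEquiv (Pi.basisFun k ι)
  let b' := b.reindex σ
  let f' : ι ≃. ι := (σ.symm.toPEquiv.trans f).trans σ.toPEquiv
  have hf' x : Matrix.toLin' N (b' x) = (f'.symm x).elim 0 b' := by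
    have : f'.symm x = (f.symm (σ.symm x)).map σ := by
      simp only [f', PEquiv.symm_trans_rev, ← Equiv.toPEquiv_symm, Equiv.symm_symm]
      change ((σ.symm.toPEquiv x).bind fun a => (f.symm a).bind σ.toPEquiv) = _
      rw [Equiv.toPEquiv_apply, Option.bind_some]
      cases f.symm (σ.symm x) <;> simp [Equiv.toPEquiv_apply]
    rw [this]
    simp only [b', Module.Basis.reindex_apply, hf]
    cases f.symm (σ.symm x) <;> simp
  let P : Matrix ι ι k := Matrix.of fun i j => b' j i
  have hP : IsUnit P := by
    have : P = (Pi.basisFun k ι).toMatrix b' := by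
      ext i j; simp [P, Module.Basis.toMatrix_apply]
    rw [this]
    let _ := (Pi.basisFun k ι).invertibleToMatrix b'
    exact isUnit_of_invertible _
  refine ⟨f', hP.unit, ?_⟩
  ext i j
  rw [PEquiv.mul_toMatrix_apply]
  have := congrFun (hf' j) i
  rw [Matrix.toLin'_apply] at this
  change (N *ᵥ (b' j)) i = _
  rw [this]
  cases f'.symm j <;> rfl

/-- A surjection `ρ : A → k` onto a field whose kernel is generated by `π`, squares to zero, and
is the annihilator of `π`. -/
structure IsLengthTwoReduction {A k : Type*} [CommRing A] [Field k] (ρ : A →+* k) (π : A) :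
    Prop where
  surjective : Function.Surjective ρ
  mul_eq_zero : ∀ x y, ρ x = 0 → ρ y = 0 → x * y = 0
  map_generator : ρ π = 0
  exists_mul_eq : ∀ x, ρ x = 0 → ∃ y, π * y = x
  map_eq_zero_of_mul : ∀ y, π * y = 0 → ρ y = 0

section Reduction

variable {A k ι H : Type*} [CommRing A] [Field k] [Fintype ι] [DecidableEq ι] [CommGroup H]
  {ρ : A →+* k} {π : A}

lemma matrix_mul_eq_zero_of_map {R S : Type*} [CommRing R] [CommRing S] {f : R →+* S}
    (hf : ∀ x y, f x = 0 → f y = 0 → x * y = 0) {M M' : Matrix ι ι R}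
    (h : f.mapMatrix M = 0) (h' : f.mapMatrix M' = 0) : M * M' = 0 := by
  ext i j
  rw [Matrix.mul_apply]
  exact Finset.sum_eq_zero fun l _ => hf _ _ (congrFun (congrFun h i) l) (congrFun (congrFun h' l) j)

lemma mul_eq_mul_of_map_eq {R S : Type*} [CommRing R] [CommRing S] {f : R →+* S}
    (hf : ∀ x y, f x = 0 → f y = 0 → x * y = 0) {Y Y' M : Matrix ι ι R}
    (h : f.mapMatrix Y = f.mapMatrix Y') (h' : f.mapMatrix M = 0) : Y * M = Y' * M := by
  rw [← sub_eq_zero, ← sub_mul]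
  exact matrix_mul_eq_zero_of_map hf (by rw [map_sub, h, sub_self]) h'

lemma mapMatrix_surjective {R S : Type*} [CommRing R] [CommRing S] {f : R →+* S}
    (hf : Function.Surjective f) :
    Function.Surjective (f.mapMatrix : Matrix ι ι R →+* Matrix ι ι S) := by
  intro M
  choose σ hσ using hf
  exact ⟨M.map σ, by ext; simp [hσ]⟩

namespace IsLengthTwoReduction

variable (hρ : IsLengthTwoReduction ρ π)
include hρ

lemma isUnit_of_map_ne_zero {x : A} (hx : ρ x ≠ 0) : IsUnit x := by
  obtain ⟨y, hy⟩ := hρ.surjective (ρ x)⁻¹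
  have hz : ρ (x * y - 1) = 0 := by simp [hy, hx]
  exact IsUnit.of_mul_eq_one (y * (1 - (x * y - 1)))
    (by linear_combination -hρ.mul_eq_zero _ _ hz hz)

lemma isUnit_matrix {Z : Matrix ι ι A} (hZ : IsUnit (ρ.mapMatrix Z)) : IsUnit Z := by
  rw [Matrix.isUnit_iff_isUnit_det] at hZ ⊢
  rw [← RingHom.map_det] at hZ
  exact hρ.isUnit_of_map_ne_zero hZ.ne_zero

lemma exists_smul_eq {M : Matrix ι ι A} (hM : ρ.mapMatrix M = 0) :
    ∃ r : Matrix ι ι A, π • r = M := by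
  choose r hr using fun i j => hρ.exists_mul_eq (M i j) (congrFun (congrFun hM i) j)
  exact ⟨Matrix.of r, by ext i j; simp [hr]⟩

lemma map_eq_zero_of_smul {M : Matrix ι ι A} (hM : π • M = 0) : ρ.mapMatrix M = 0 := by
  ext i j
  exact hρ.map_eq_zero_of_mul _ (congrFun (congrFun hM i) j)

/-- A nilpotent matrix has a lift whose centralizer surjects onto the centralizer of the matrix. -/
lemma exists_lift_centralizer {N : Matrix ι ι k} (hN : IsNilpotent N) :
    ∃ N' : Matrix ι ι A, ρ.mapMatrix N' = N ∧
      ∀ r, Commute r N → ∃ r', ρ.mapMatrix r' = r ∧ Commute r' N' := by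
  obtain ⟨f, P, hP⟩ := exists_pequiv_of_isNilpotent N hN
  obtain ⟨P', hP'⟩ := mapMatrix_surjective (ι := ι) hρ.surjective (P : Matrix ι ι k)
  obtain ⟨P', rfl⟩ := hρ.isUnit_matrix (by rw [hP']; exact P.isUnit)
  have hPi : ρ.mapMatrix ((P'⁻¹ : GL ι A) : Matrix ι ι A) =
      ((P⁻¹ : GL ι k) : Matrix ι ι k) := by
    rw [← Units.mul_right_inj P, Units.mul_inv, ← hP', ← map_mul, Units.mul_inv, map_one]
  have hN' : N = (P : Matrix ι ι k) * f.toMatrix * ((P⁻¹ : GL ι k) : Matrix ι ι k) := by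
    rw [← hP, mul_assoc, Units.mul_inv, mul_one]
  have hJ : ρ.mapMatrix (f.toMatrix : Matrix ι ι A) = f.toMatrix := PEquiv.map_toMatrix ρ f
  refine ⟨(P' : Matrix ι ι A) * f.toMatrix * ((P'⁻¹ : GL ι A) : Matrix ι ι A),
    by rw [map_mul, map_mul, hP', hPi, hJ, hN'], fun r hr => ?_⟩
  obtain ⟨σ, hσ, hσ0⟩ : ∃ σ : k → A, (∀ x, ρ (σ x) = x) ∧ σ 0 = 0 := by
    choose σ hσ using hρ.surjective
    exact ⟨fun x => σ x - σ 0, fun x => by simp [hσ], sub_self _⟩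
  set s : Matrix ι ι k := ((P⁻¹ : GL ι k) : Matrix ι ι k) * r * P with hs
  have hcomm : s * f.toMatrix = f.toMatrix * s := by
    have : (f.toMatrix : Matrix ι ι k) = ((P⁻¹ : GL ι k) : Matrix ι ι k) * N * P := by
      rw [mul_assoc, hP, Units.inv_mul_cancel_left]
    rw [this, hs]
    simp only [mul_assoc, Units.mul_inv_cancel_left]
    rw [← mul_assoc r, ← mul_assoc N, hr.eq]
  have hcomm' : s.map σ * f.toMatrix = f.toMatrix * s.map σ := by
    ext i j
    have := congrFun (congrFun hcomm i) j
    rw [PEquiv.toMatrix_mul_apply, PEquiv.mul_toMatrix_apply] at this ⊢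
    have h := congrArg σ this
    revert h
    cases f i <;> cases f.symm j <;> simp [hσ0]
  refine ⟨(P' : Matrix ι ι A) * s.map σ * ((P'⁻¹ : GL ι A) : Matrix ι ι A), ?_, ?_⟩
  · have : ρ.mapMatrix (s.map σ) = s := by ext; simp [hσ]
    rw [map_mul, map_mul, hP', hPi, this, hs]
    simp only [mul_assoc, Units.mul_inv_cancel_left, Units.mul_inv, mul_one]
  · change _ * _ = _ * _
    simp only [mul_assoc, Units.inv_mul_cancel_left]
    rw [← mul_assoc (s.map σ), hcomm', mul_assoc]

lemma trace_mul_eq_zero {N : Matrix ι ι A} (hN : IsNilpotent (ρ.mapMatrix N)) {M : Matrix ι ι A}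
    (hM : ρ.mapMatrix M = 0) (hc : Commute M N) : (N * M).trace = 0 := by
  obtain ⟨r, rfl⟩ := hρ.exists_smul_eq hM
  have hr : Commute (ρ.mapMatrix r) (ρ.mapMatrix N) := by
    rw [commute_iff_eq, ← sub_eq_zero, ← map_mul, ← map_mul, ← map_sub]
    apply hρ.map_eq_zero_of_smul
    rw [smul_sub, ← smul_mul_assoc, ← mul_smul_comm, hc.eq, sub_self]
  have : ρ (N * r).trace = 0 := by
    have h := (Matrix.isNilpotent_trace_of_isNilpotent (hr.symm.isNilpotent_mul_right hN)).eq_zero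
    rw [← map_mul] at h
    rw [← h, Matrix.trace, map_sum]
    rfl
  rw [mul_smul_comm, Matrix.trace_smul]
  exact hρ.mul_eq_zero _ _ hρ.map_generator this

end IsLengthTwoReduction

/-- The character `g ↦ ω (tr (Y (g - 1)))` of the kernel of `GL ι A → GL ι k`, for `Y` a lift of
`X`, extends to the stabilizer of `X`. -/
def KernelCharExtends (ρ : A →+* k) (ω : AddChar A H) (X : Matrix ι ι k) : Prop :=
  ∃ f : GL ι A → H,
    (∀ g h : GL ι A, Commute (ρ.mapMatrix (g : Matrix ι ι A)) X →
      Commute (ρ.mapMatrix (h : Matrix ι ι A)) X → f (g * h) = f g * f h) ∧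
    ∀ (Y : Matrix ι ι A) (g : GL ι A), ρ.mapMatrix Y = X → ρ.mapMatrix (g : Matrix ι ι A) = 1 →
      f g = ω (Y * (g - 1 : Matrix ι ι A)).trace

namespace IsLengthTwoReduction

variable (hρ : IsLengthTwoReduction ρ π)
include hρ

lemma trace_mul_sub_one (Y : Matrix ι ι A) {u v : Matrix ι ι A} (hu : ρ.mapMatrix u = 1)
    (hv : ρ.mapMatrix v = 1) :
    (Y * (u * v - 1)).trace = (Y * (u - 1)).trace + (Y * (v - 1)).trace := by
  have h : (u - 1) * (v - 1) = 0 := matrix_mul_eq_zero_of_map hρ.mul_eq_zero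
    (by rw [map_sub, hu, map_one, sub_self]) (by rw [map_sub, hv, map_one, sub_self])
  rw [← Matrix.trace_add, ← mul_add]
  congr 2
  rw [← sub_eq_zero, ← h]
  noncomm_ring

lemma kernelCharExtends_of_isNilpotent (ω : AddChar A H) {N : Matrix ι ι k}
    (hN : IsNilpotent N) : KernelCharExtends ρ ω N := by
  obtain ⟨N', rfl, hlift⟩ := hρ.exists_lift_centralizer hN
  have hz (g : GL ι A) : ∃ z : GL ι A, Commute (ρ.mapMatrix (g : Matrix ι ι A)) (ρ.mapMatrix N') →
      ρ.mapMatrix (z : Matrix ι ι A) = ρ.mapMatrix (g : Matrix ι ι A) ∧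
        Commute (z : Matrix ι ι A) N' := by
    by_cases hg : Commute (ρ.mapMatrix (g : Matrix ι ι A)) (ρ.mapMatrix N')
    · obtain ⟨r, hr, hc⟩ := hlift _ hg
      obtain ⟨z, rfl⟩ := hρ.isUnit_matrix (by rw [hr]; exact g.isUnit.map _)
      exact ⟨z, fun _ => ⟨hr, hc⟩⟩
    · exact ⟨1, fun h => absurd h hg⟩
  choose z hz using hz
  have hinv {a b : GL ι A} (h : ρ.mapMatrix (a : Matrix ι ι A) = ρ.mapMatrix (b : Matrix ι ι A)) :
      ρ.mapMatrix ((a * b⁻¹ : GL ι A) : Matrix ι ι A) = 1 := by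
    rw [Units.val_mul, map_mul, h, ← map_mul, Units.mul_inv, map_one]
  have hzero {a : GL ι A} (ha : ρ.mapMatrix (a : Matrix ι ι A) = 1)
      (hc : Commute (a : Matrix ι ι A) N') : (N' * (a - 1 : Matrix ι ι A)).trace = 0 :=
    hρ.trace_mul_eq_zero hN (by rw [map_sub, ha, map_one, sub_self])
      (hc.sub_left (Commute.one_left _))
  refine ⟨fun g => ω (N' * ((g * (z g)⁻¹ : GL ι A) - 1 : Matrix ι ι A)).trace,
    fun g h hg hh => ?_, fun Y g hY hg => ?_⟩
  · have hgh : Commute (ρ.mapMatrix ((g * h : GL ι A) : Matrix ι ι A)) (ρ.mapMatrix N') := by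
      rw [Units.val_mul, map_mul]
      exact hg.mul_left hh
    obtain ⟨h1, c1⟩ := hz g hg
    obtain ⟨h2, c2⟩ := hz h hh
    obtain ⟨h3, c3⟩ := hz _ hgh
    have hfac : g * h * (z (g * h))⁻¹ = (g * (z g)⁻¹) *
        ((z g * (h * (z h)⁻¹) * (z g)⁻¹) * (z g * z h * (z (g * h))⁻¹)) := by group
    have e1 := hinv h1.symm
    have e2 : ρ.mapMatrix ((z g * (h * (z h)⁻¹) * (z g)⁻¹ : GL ι A) : Matrix ι ι A) = 1 := by
      rw [Units.val_mul, Units.val_mul, map_mul, map_mul, hinv h2.symm, mul_one, ← map_mul,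
        Units.mul_inv, map_one]
    have e3 : ρ.mapMatrix ((z g * z h * (z (g * h))⁻¹ : GL ι A) : Matrix ι ι A) = 1 :=
      hinv (by rw [h3, Units.val_mul, map_mul, Units.val_mul, map_mul, h1, h2])
    have e23 : ρ.mapMatrix (((z g * (h * (z h)⁻¹) * (z g)⁻¹) * (z g * z h * (z (g * h))⁻¹) :
        GL ι A) : Matrix ι ι A) = 1 := by rw [Units.val_mul, map_mul, e2, e3, mul_one]
    have hconj : (N' * ((z g * (h * (z h)⁻¹) * (z g)⁻¹ : GL ι A) - 1 : Matrix ι ι A)).trace =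
        (N' * ((h * (z h)⁻¹ : GL ι A) - 1 : Matrix ι ι A)).trace := by
      have : N' * ((z g * (h * (z h)⁻¹) * (z g)⁻¹ : GL ι A) - 1 : Matrix ι ι A) =
          z g * (N' * ((h * (z h)⁻¹ : GL ι A) - 1 : Matrix ι ι A) * ((z g)⁻¹ : GL ι A)) := by
        generalize h * (z h)⁻¹ = v
        rw [← mul_assoc, ← mul_assoc (z g : Matrix ι ι A), c1.eq]
        simp only [Units.val_mul, mul_sub, sub_mul, mul_assoc, mul_one, Units.mul_inv]
      rw [this, Matrix.trace_mul_comm, mul_assoc, Units.inv_mul, mul_one]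
    beta_reduce
    rw [hfac, Units.val_mul, hρ.trace_mul_sub_one N' e1 e23, Units.val_mul _ (z g * z h * _),
      hρ.trace_mul_sub_one N' e2 e3, hconj, hzero e3, add_zero, AddChar.map_add_eq_mul]
    rw [Units.val_mul, Units.val_mul]
    exact (c1.mul_left c2).mul_left c3.units_inv_left
  · obtain ⟨h1, c1⟩ := hz g (by rw [hg]; exact Commute.one_left _)
    have hg' : (g : Matrix ι ι A) = (g * (z g)⁻¹ : GL ι A) * (z g : Matrix ι ι A) := by
      rw [← Units.val_mul]; simp
    rw [mul_eq_mul_of_map_eq hρ.mul_eq_zero hY (by rw [map_sub, hg, map_one, sub_self])]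
    conv_rhs => rw [hg']
    rw [hρ.trace_mul_sub_one N' (hinv h1.symm) (h1.trans hg), hzero (h1.trans hg) c1, add_zero]

end IsLengthTwoReduction

end Reduction

section Semisimple

lemma exists_isIdempotentElem_coeff {k ι : Type*} [Field k] [Fintype ι] [DecidableEq ι] {m : ℕ}
    [NeZero m] (hm : (m : k) = -1) {X : Matrix ι ι k} (hX : X ^ (m + 1) = X) :
    ∃ E : Matrix ι ι (MonoidAlgebra k (Multiplicative (ZMod m))), IsIdempotentElem E ∧
      (∀ a b, (E a b).coeff (Multiplicative.ofAdd 1) = -X a b) ∧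
      ∀ r, Commute r X → Commute (MonoidAlgebra.singleOneRingHom.mapMatrix r) E := by
  set φ : Matrix ι ι k →+* Matrix ι ι (MonoidAlgebra k (Multiplicative (ZMod m))) := MonoidAlgebra.singleOneRingHom.mapMatrix with hφ
  set t : MonoidAlgebra k (Multiplicative (ZMod m)) := MonoidAlgebra.single (Multiplicative.ofAdd 1) 1 with ht
  have htp (i : ℕ) : t ^ i = MonoidAlgebra.single (Multiplicative.ofAdd (i : ZMod m)) 1 := by
    rw [ht, MonoidAlgebra.single_pow, one_pow, ← ofAdd_nsmul, nsmul_one]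
  set Z : Matrix ι ι (MonoidAlgebra k (Multiplicative (ZMod m))) := t • φ X with hZ
  have hZp (i : ℕ) : Z ^ i = t ^ i • φ (X ^ i) := by rw [hZ, smul_pow, map_pow]
  have hZm : Z ^ (m + 1) = Z := by
    rw [hZp, hX, htp, hZ, ht]; simp
  have hsum : Z * ∑ i ∈ Finset.range m, Z ^ (i + 1) = ∑ i ∈ Finset.range m, Z ^ (i + 1) := by
    have h := Finset.sum_range_succ' (fun i => Z ^ (i + 1)) m
    rw [Finset.sum_range_succ, hZm, zero_add, pow_one, add_left_inj] at h
    rw [Finset.mul_sum, h]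
    exact Finset.sum_congr rfl fun i _ => (pow_succ' _ _).symm
  have hpow (i : ℕ) : Z ^ i * ∑ i ∈ Finset.range m, Z ^ (i + 1) =
      ∑ i ∈ Finset.range m, Z ^ (i + 1) := by
    induction i with
    | zero => rw [pow_zero, one_mul]
    | succ i ih => rw [pow_succ, mul_assoc, hsum, ih]
  refine ⟨-∑ i ∈ Finset.range m, Z ^ (i + 1), ?_, fun a b => ?_, fun r hr => ?_⟩
  · have hmB : (m : Matrix ι ι (MonoidAlgebra k (Multiplicative (ZMod m)))) = -1 := by
      rw [← map_natCast (φ.comp (Matrix.scalar ι)), hm, map_neg, map_one]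
    rw [IsIdempotentElem, neg_mul_neg, Finset.sum_mul, Finset.sum_congr rfl fun i _ => hpow (i + 1),
      Finset.sum_const, Finset.card_range, nsmul_eq_mul, hmB, neg_one_mul]
  · rw [Matrix.neg_apply, Matrix.sum_apply, MonoidAlgebra.coeff_neg, MonoidAlgebra.coeff_sum,
      Finsupp.neg_apply, Finsupp.finsetSum_apply, Finset.sum_eq_single_of_mem 0]
    · rw [hZp, htp]
      simp [hφ, MonoidAlgebra.single_mul_single]
    · exact Finset.mem_range.2 (NeZero.pos m)
    · intro i hi h0
      rw [hZp, htp]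
      have : ((i : ZMod m)) ≠ 0 := by
        rw [Ne, ZMod.natCast_eq_zero_iff]
        exact Nat.not_dvd_of_pos_of_lt (Nat.pos_of_ne_zero h0) (Finset.mem_range.1 hi)
      simp [hφ, MonoidAlgebra.single_mul_single, this]
  · refine Commute.neg_right (Commute.sum_right _ _ _ fun i _ => Commute.pow_right ?_ _)
    rw [hZ]
    exact (hr.map φ).smul_right t

lemma det_compression_mul {R S ι : Type*} [CommRing R] [CommRing S] [Fintype ι] [DecidableEq ι]
    {f : R →+* S} (hf : ∀ x y, f x = 0 → f y = 0 → x * y = 0) {E u v : Matrix ι ι R}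
    (hE : IsIdempotentElem E) (hu : Commute (f.mapMatrix u) (f.mapMatrix E))
    (hv : Commute (f.mapMatrix v) (f.mapMatrix E)) :
    (E * (u * v) * E + (1 - E)).det = (E * u * E + (1 - E)).det * (E * v * E + (1 - E)).det := by
  have hE' : f.mapMatrix E * f.mapMatrix E = f.mapMatrix E := by rw [← map_mul, hE.eq]
  have h1 : f.mapMatrix (E * u * (1 - E)) = 0 := by
    rw [map_mul, map_mul, map_sub, map_one, ← hu.eq, mul_assoc, mul_sub, hE', mul_one, sub_self,
      mul_zero]
  have h2 : f.mapMatrix ((1 - E) * v * E) = 0 := by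
    rw [map_mul, map_mul, map_sub, map_one, mul_assoc, hv.eq, ← mul_assoc, sub_mul, hE', one_mul,
      sub_self, zero_mul]
  have h := matrix_mul_eq_zero_of_map hf h1 h2
  have hE0 : (1 - E) * (1 - E) = 1 - E := hE.one_sub.eq
  rw [← Matrix.det_mul]
  congr 1
  have hr : E * (1 - E) = 0 := by rw [mul_sub, hE.eq, mul_one, sub_self]
  have hl : (1 - E) * E = 0 := by rw [sub_mul, hE.eq, one_mul, sub_self]
  have e1 : (E * u * E + (1 - E)) * (E * v * E + (1 - E)) =
      E * u * (E * E) * v * E + E * u * (E * (1 - E)) + ((1 - E) * E) * v * E +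
        (1 - E) * (1 - E) := by noncomm_ring
  have e2 : E * u * (1 - E) * ((1 - E) * v * E) = E * u * ((1 - E) * (1 - E)) * v * E := by
    noncomm_ring
  rw [e2, hE0] at h
  have e3 : E * (u * v) * E = E * u * E * v * E := by
    rw [← sub_eq_zero, ← h]
    noncomm_ring
  rw [e1, hE.eq, hr, hl, hE0, mul_zero, zero_mul, zero_mul, add_zero, add_zero, e3]

lemma det_compression_eq {R ι : Type*} [CommRing R] [Fintype ι] [DecidableEq ι] {s : R}
    (hs : s * s = 0) {E r : Matrix ι ι R} (hE : IsIdempotentElem E) :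
    (E * (1 + s • r) * E + (1 - E)).det = 1 + (E * s • r).trace := by
  have : E * (1 + s • r) * E + (1 - E) = 1 + s • (E * r * E) := by
    rw [mul_add, add_mul, mul_one, hE.eq, mul_smul_comm, smul_mul_assoc]; abel
  rw [this, Matrix.det_one_add_smul, pow_two, hs, mul_zero, add_zero, Matrix.trace_mul_comm,
    ← mul_assoc, hE.eq, mul_smul_comm, Matrix.trace_smul, smul_eq_mul, mul_comm]

end Semisimple

section Semisimple

variable {A k ι H : Type*} [CommRing A] [Field k] [Fintype ι] [DecidableEq ι] [CommGroup H]
  {ρ : A →+* k} {π : A}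

lemma monoidAlgebra_pow_eq_self {p j m : ℕ} [Fact p.Prime] [CharP k p] [NeZero m]
    (hm : m + 1 = p ^ j) (hk : ∀ a : k, a ^ (m + 1) = a)
    (b : MonoidAlgebra k (Multiplicative (ZMod m))) : b ^ (m + 1) = b := by
  have : CharP (MonoidAlgebra k (Multiplicative (ZMod m))) p :=
    charP_of_injective_algebraMap (algebraMap k _).injective p
  have h : iterateFrobenius (MonoidAlgebra k (Multiplicative (ZMod m))) p j = RingHom.id _ := by
    refine MonoidAlgebra.ringHom_ext (fun r => ?_) fun g => ?_
    · rw [iterateFrobenius_def, ← hm, MonoidAlgebra.single_pow, one_pow, hk, RingHom.id_apply]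
    · have hg : g ^ m = 1 := by
        have := pow_card_eq_one' (x := g)
        rwa [Nat.card_congr Multiplicative.toAdd, Nat.card_zmod] at this
      rw [iterateFrobenius_def, ← hm, MonoidAlgebra.single_pow, one_pow, pow_succ, hg, one_mul,
        RingHom.id_apply]
  have := congrArg (fun F => F b) h
  simpa [iterateFrobenius_def, ← hm] using this

namespace IsLengthTwoReduction

variable (hρ : IsLengthTwoReduction ρ π)
include hρ

lemma kernelCharExtends_of_pow_eq (ω : AddChar A H) {p j m : ℕ} [Fact p.Prime] [CharP k p]
    [NeZero m] (hm : m + 1 = p ^ j) (hj : j ≠ 0) (hk : ∀ a : k, a ^ (m + 1) = a)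
    {X : Matrix ι ι k} (hX : X ^ (m + 1) = X) : KernelCharExtends ρ ω X := by
  have hm0 : ((m + 1 : ℕ) : k) = 0 := by
    rw [hm, Nat.cast_pow, CharP.cast_eq_zero, zero_pow hj]
  obtain ⟨E, hE, hEX, hEc⟩ := exists_isIdempotentElem_coeff (m := m)
    (by rw [eq_neg_iff_add_eq_zero]; exact_mod_cast hm0) hX
  set F : MonoidAlgebra A (Multiplicative (ZMod m)) →+* MonoidAlgebra k (Multiplicative (ZMod m)) :=
    MonoidAlgebra.mapRingHom _ ρ with hF
  set φ : Matrix ι ι A →+* Matrix ι ι (MonoidAlgebra A (Multiplicative (ZMod m))) :=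
    MonoidAlgebra.singleOneRingHom.mapMatrix with hφ
  have hFs : Function.Surjective F := by
    intro x
    induction x using MonoidAlgebra.induction_linear with
    | zero => exact ⟨0, map_zero _⟩
    | add x y hx hy =>
      obtain ⟨a, rfl⟩ := hx
      obtain ⟨b, rfl⟩ := hy
      exact ⟨a + b, map_add _ _ _⟩
    | single g r =>
      obtain ⟨a, rfl⟩ := hρ.surjective r
      exact ⟨MonoidAlgebra.single g a, MonoidAlgebra.mapRingHom_single _ _ _⟩
  have hF0 : ∀ x y, F x = 0 → F y = 0 → x * y = 0 := by
    intro x y hx hy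
    ext g
    rw [MonoidAlgebra.coeff_mul]
    refine Finset.sum_eq_zero fun a _ => Finset.sum_eq_zero fun b _ => ?_
    dsimp only
    rw [hρ.mul_eq_zero, ite_self]
    · rw [← MonoidAlgebra.coeff_mapRingHom, ← hF, hx]; rfl
    · rw [← MonoidAlgebra.coeff_mapRingHom, ← hF, hy]; rfl
  have hFφ (M : Matrix ι ι A) : F.mapMatrix (φ M) =
      MonoidAlgebra.singleOneRingHom.mapMatrix (ρ.mapMatrix M) := by
    refine Matrix.ext fun a b => ?_
    exact MonoidAlgebra.mapRingHom_single _ _ _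
  obtain ⟨E', hE', rfl⟩ := exists_isIdempotentElem_eq_of_ker_isNilpotent (F.mapMatrix (m := ι))
    (fun x hx => ⟨2, by rw [pow_two]; exact matrix_mul_eq_zero_of_map hF0 hx hx⟩) E
    (mapMatrix_surjective hFs E) hE
  set D : GL ι A → MonoidAlgebra A (Multiplicative (ZMod m)) :=
    fun g => (E' * φ g * E' + (1 - E')).det with hD
  have hDmul (g h : GL ι A) (hg : Commute (ρ.mapMatrix (g : Matrix ι ι A)) X)
      (hh : Commute (ρ.mapMatrix (h : Matrix ι ι A)) X) : D (g * h) = D g * D h := by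
    rw [hD]
    beta_reduce
    rw [Units.val_mul, map_mul]
    exact det_compression_mul hF0 hE' (by rw [hFφ]; exact hEc _ hg) (by rw [hFφ]; exact hEc _ hh)
  have hDone : D 1 = 1 := by simp [hD, hE'.eq]
  have hDpow (g : GL ι A) (hg : Commute (ρ.mapMatrix (g : Matrix ι ι A)) X) :
      F (D g ^ m - 1) = 0 := by
    have hgi : Commute (ρ.mapMatrix ((g⁻¹ : GL ι A) : Matrix ι ι A)) X :=
      Commute.units_inv_left (u := Units.map (ρ.mapMatrix : Matrix ι ι A →+* _).toMonoidHom g) hg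
    have hu : IsUnit (F (D g)) :=
      (IsUnit.of_mul_eq_one (D g⁻¹) (by rw [← hDmul _ _ hg hgi, mul_inv_cancel, hDone])).map F
    have := monoidAlgebra_pow_eq_self hm hk (F (D g))
    rw [pow_succ] at this
    rw [map_sub, map_one, map_pow, sub_eq_zero]
    exact hu.mul_right_cancel (by rw [this, one_mul])
  refine ⟨fun g => ω ((D g ^ m - 1).coeff (Multiplicative.ofAdd 1)), fun g h hg hh => ?_,
    fun Y g hY hg => ?_⟩
  · beta_reduce
    rw [← AddChar.map_add_eq_mul, ← Finsupp.add_apply, ← MonoidAlgebra.coeff_add, hDmul _ _ hg hh]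
    congr 3
    have := hF0 _ _ (hDpow g hg) (hDpow h hh)
    rw [mul_pow]
    linear_combination this
  · have hM : ρ.mapMatrix ((g : Matrix ι ι A) - 1) = 0 := by rw [map_sub, hg, map_one, sub_self]
    obtain ⟨r, hr⟩ := hρ.exists_smul_eq hM
    set s : MonoidAlgebra A (Multiplicative (ZMod m)) := MonoidAlgebra.singleOneRingHom π with hs
    have hss : s * s = 0 := by
      rw [hs, ← map_mul, hρ.mul_eq_zero _ _ hρ.map_generator hρ.map_generator, map_zero]
    have hφs : s • φ r = φ (g - 1) := by
      rw [← hr]; ext a b : 2; simp [hs, hφ]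
    have hDg : D g = 1 + (E' * φ (g - 1)).trace := by
      rw [← hφs, ← det_compression_eq hss hE', hφs, map_sub, map_one, add_sub_cancel]
    have hv : F (E' * φ (g - 1)).trace = 0 := by
      have : F.mapMatrix (E' * φ (g - 1)) = 0 := by rw [map_mul, hFφ, hM, map_zero, mul_zero]
      rw [Matrix.trace, map_sum]
      exact Finset.sum_eq_zero fun i _ => congrFun (congrFun this i) i
    have hpow : D g ^ m - 1 = -(E' * φ (g - 1)).trace := by
      generalize (E' * φ (g - 1)).trace = v at hDg hv
      have h (i : ℕ) : (1 + v) ^ i = 1 + i * v := by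
        induction i with
        | zero => simp
        | succ i ih =>
          rw [pow_succ, ih]; push_cast
          linear_combination (i : MonoidAlgebra A (Multiplicative (ZMod m))) * hF0 _ _ hv hv
      have h0 := hF0 ((m + 1 : ℕ) : MonoidAlgebra A (Multiplicative (ZMod m))) v (by
        rw [map_natCast, ← map_natCast MonoidAlgebra.singleOneRingHom, hm0, map_zero]) hv
      push_cast at h0
      rw [hDg, h]
      linear_combination h0
    beta_reduce
    rw [hpow]
    congr 1
    have hcoeff : (E' * φ (g - 1)).trace.coeff (Multiplicative.ofAdd 1) =
        (Matrix.of (fun a b => (E' a b).coeff (Multiplicative.ofAdd 1)) * (g - 1 : Matrix ι ι A)).trace := by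
      rw [Matrix.trace, Matrix.trace, MonoidAlgebra.coeff_sum, Finsupp.finsetSum_apply]
      refine Finset.sum_congr rfl fun a _ => ?_
      rw [Matrix.diag_apply, Matrix.diag_apply, Matrix.mul_apply, Matrix.mul_apply,
        MonoidAlgebra.coeff_sum, Finsupp.finsetSum_apply]
      refine Finset.sum_congr rfl fun b _ => ?_
      exact MonoidAlgebra.coeff_mul_single_one _ _ _
    rw [MonoidAlgebra.coeff_neg, Finsupp.neg_apply, hcoeff, ← Matrix.trace_neg, ← neg_mul]
    congr 1
    refine mul_eq_mul_of_map_eq hρ.mul_eq_zero ?_ hM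
    rw [hY]
    ext a b
    have := hEX a b
    rw [RingHom.mapMatrix_apply, Matrix.map_apply, hF, MonoidAlgebra.coeff_mapRingHom] at this
    simp [this]

end IsLengthTwoReduction

end Semisimple

section Stabilizer

lemma exists_iterate_iterate_eq {α : Type*} [Finite α] (φ : α → α) (x : α) :
    ∃ i, i ≠ 0 ∧ φ^[i] (φ^[i] x) = φ^[i] x := by
  obtain ⟨a, b, hab, h⟩ : ∃ a b : ℕ, a < b ∧ φ^[a] x = φ^[b] x := by
    obtain ⟨a, b, hne, h⟩ := Finite.exists_ne_map_eq_of_infinite fun n : ℕ => φ^[n] x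
    rcases lt_or_gt_of_ne hne with hlt | hlt
    exacts [⟨a, b, hlt, h⟩, ⟨b, a, hlt, h.symm⟩]
  obtain ⟨c, rfl⟩ := Nat.exists_eq_add_of_lt hab
  have hper (n : ℕ) : φ^[(c + 1) * n] (φ^[a] x) = φ^[a] x := by
    rw [Function.iterate_mul]
    refine Function.iterate_fixed ?_ n
    rw [← Function.iterate_add_apply, h]
    exact congrArg (fun n => φ^[n] x) (by omega)
  refine ⟨(c + 1) * (a + 1), by positivity, ?_⟩
  obtain ⟨e, he⟩ : ∃ e, (c + 1) * (a + 1) = e + a := ⟨(c + 1) * (a + 1) - a, by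
    have : a + 1 ≤ (c + 1) * (a + 1) := Nat.le_mul_of_pos_left _ (by omega)
    omega⟩
  have hx : φ^[(c + 1) * (a + 1)] x = φ^[e] (φ^[a] x) := by rw [he, Function.iterate_add_apply]
  rw [hx, ← Function.iterate_add_apply, add_comm, Function.iterate_add_apply, hper]

variable {A k ι H : Type*} [CommRing A] [Field k] [Fintype ι] [DecidableEq ι] [CommGroup H]
  {ρ : A →+* k} {π : A}

namespace IsLengthTwoReduction

variable (hρ : IsLengthTwoReduction ρ π)
include hρ

theorem kernelCharExtends [Finite k] (ω : AddChar A H) (X : Matrix ι ι k) :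
    KernelCharExtends ρ ω X := by
  have := Fintype.ofFinite k
  obtain ⟨p, hchar⟩ := CharP.exists k
  obtain ⟨d, hp, hcard⟩ := FiniteField.card k p
  have : Fact p.Prime := ⟨hp⟩
  obtain ⟨i, hi, hX⟩ := exists_iterate_iterate_eq (fun M : Matrix ι ι k => M ^ Fintype.card k) X
  rw [pow_iterate] at hX
  beta_reduce at hX
  have hpos : 1 < Fintype.card k ^ i := Nat.one_lt_pow hi Fintype.one_lt_card
  obtain ⟨m, hm⟩ := Nat.exists_eq_add_of_lt hpos
  have hQ : Fintype.card k ^ i = p ^ (d * i : ℕ) := by rw [hcard, pow_mul]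
  have hm1 : Fintype.card k ^ i = m + 1 + 1 := by omega
  have hk (a : k) : a ^ (Fintype.card k ^ i) = a := FiniteField.pow_card_pow i a
  obtain ⟨f₁, hf₁, hf₁'⟩ := hρ.kernelCharExtends_of_pow_eq (m := m + 1) ω (hm1.symm.trans hQ)
    (mul_ne_zero d.ne_zero hi) (by rwa [← hm1]) (by rw [← hm1]; exact hX)
  have hN : IsNilpotent (X - X ^ (Fintype.card k ^ i)) := by
    refine ⟨Fintype.card k ^ i, ?_⟩
    cases isEmpty_or_nonempty ι
    · exact Subsingleton.elim _ _
    have : CharP (Matrix ι ι k) p := inferInstance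
    rw [hQ, sub_pow_char_pow_of_commute _ _ (Commute.pow_right (Commute.refl X) _), ← hQ, hX,
      sub_self]
  obtain ⟨f₂, hf₂, hf₂'⟩ := hρ.kernelCharExtends_of_isNilpotent ω hN
  refine ⟨fun g => f₁ g * f₂ g, fun g h hg hh => ?_, fun Y g hY hg => ?_⟩
  · beta_reduce
    rw [hf₁ g h (hg.pow_right _) (hh.pow_right _),
      hf₂ g h (hg.sub_right (hg.pow_right _)) (hh.sub_right (hh.pow_right _)), mul_mul_mul_comm]
  · obtain ⟨S, hS⟩ := mapMatrix_surjective hρ.surjective (X ^ (Fintype.card k ^ i))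
    beta_reduce
    rw [hf₁' S g hS hg, hf₂' (Y - S) g (by rw [map_sub, hY, hS]) hg, ← AddChar.map_add_eq_mul,
      ← Matrix.trace_add, ← add_mul, add_sub_cancel]

end IsLengthTwoReduction

end Stabilizer

section Cocycle

/-- Multiplicative functions on the stabilizers of an action extend to a cocycle. -/
lemma exists_cocycle_of_stabilizer {G α H : Type*} [Group G] [CommGroup H] (σ : G →* Equiv.Perm α)
    (f : α → G → H)
    (hf : ∀ x g h, σ g x = x → σ h x = x → f x (g * h) = f x g * f x h) :
    ∃ c : G → α → H, (∀ g h x, c (g * h) x = c g (σ h x) * c h x) ∧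
      ∀ x, ∃ x₀ γ, σ γ x₀ = x ∧ ∀ n, σ n x = x → c n x = f x₀ (γ⁻¹ * n * γ) := by
  let s : Setoid α :=
    { r := fun x y => ∃ γ, σ γ x = y
      iseqv :=
        { refl := fun x => ⟨1, by simp⟩
          symm := fun ⟨γ, h⟩ => ⟨γ⁻¹, by simp [← h]⟩
          trans := fun ⟨γ, h⟩ ⟨δ, h'⟩ => ⟨δ * γ, by simp [h, h']⟩ } }
  let rep : α → α := fun x => (Quotient.mk s x).out
  have hrep (g : G) (x : α) : rep (σ g x) = rep x :=
    congrArg Quotient.out (Quotient.sound (s := s) (show ∃ γ, σ γ (σ g x) = x from ⟨g⁻¹, by simp⟩))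
  have hγ (x : α) : ∃ γ, σ γ (rep x) = x := Quotient.mk_out (s := s) x
  choose γ hγ using hγ
  have hγ' (x : α) : (σ (γ x)).symm x = rep x := by rw [Equiv.symm_apply_eq, hγ]
  have hstab (g : G) (x : α) : σ ((γ (σ g x))⁻¹ * g * γ x) (rep x) = rep x := by
    simp [hγ, hγ', hrep]
  refine ⟨fun g x => f (rep x) ((γ (σ g x))⁻¹ * g * γ x), fun g h x => ?_,
    fun x => ⟨rep x, γ x, hγ x, fun n hn => by simp only [hn]⟩⟩
  have h1 := hstab g (σ h x)
  rw [hrep] at h1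
  beta_reduce
  rw [hrep, ← hf _ _ _ h1 (hstab h x), map_mul, Equiv.Perm.mul_apply]
  congr 1
  group

lemma sum_cocycle_kernel_eq_zero {K N : Type*} [Field K] [Group N] [Fintype N] (χ ψ : N →* Kˣ)
    (h : χ ≠ ψ) : ∑ n, (ψ n : K)⁻¹ * χ n = 0 := by
  have : (Units.coeHom K).comp (ψ⁻¹ * χ) ≠ 1 := by
    intro h'
    refine h (MonoidHom.ext fun n => ?_)
    have := DFunLike.congr_fun h' n
    have h2 : (ψ n)⁻¹ * χ n = 1 := Units.ext (by simpa using this)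
    exact (inv_mul_eq_one.1 h2).symm
  rw [← sum_hom_units_eq_zero _ this]
  simp

variable {K G Q α : Type*} [Field K] [Group G] [Group Q] [Fintype α] [DecidableEq α]

/-- The elements of the standard basis of the crossed product of `α → K` and `Q`, realized as
matrices over the group algebra of `Q`. -/
noncomputable def crossedBasis (K : Type*) [Field K] (τ : Q →* Equiv.Perm α) (x : α × Q) :
    Matrix α α (MonoidAlgebra K Q) :=
  Matrix.single (τ x.2 x.1) x.1 (MonoidAlgebra.single x.2 1)

lemma crossedBasis_mul (τ : Q →* Equiv.Perm α) (x y : α) (g h : Q) :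
    crossedBasis K τ (x, g) * crossedBasis K τ (y, h) =
      if x = τ h y then crossedBasis K τ (y, g * h) else 0 := by
  unfold crossedBasis
  split_ifs with hx
  · subst hx
    simp [MonoidAlgebra.single_mul_single]
  · exact Matrix.single_mul_single_of_ne _ _ _ _ hx _

omit [Fintype α] in
lemma linearIndependent_crossedBasis (τ : Q →* Equiv.Perm α) :
    LinearIndependent K (crossedBasis K τ) := by
  rw [linearIndependent_iff]
  intro l hl
  ext ⟨x, h⟩
  have := congrArg (fun M => (M (τ h x) x).coeff h) hl
  classical
  rw [Finsupp.linearCombination_apply, Finsupp.sum] at this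
  simp only [Matrix.sum_apply, MonoidAlgebra.coeff_sum, Finsupp.finsetSum_apply] at this
  rw [Finset.sum_eq_single (x, h)] at this
  · simpa [crossedBasis] using this
  · rintro ⟨y, g⟩ - hne
    by_cases hy : y = x
    · subst hy
      have hg : g ≠ h := fun e => hne (by rw [e])
      simp only [crossedBasis, Matrix.smul_apply, Matrix.single_apply]
      split_ifs <;> simp [hg]
    · simp [crossedBasis, hy]
  · intro hx
    simp [Finsupp.notMem_support_iff.1 hx]

theorem exists_injective_range_eq_span_crossedBasis [Finite G] [Finite Q] {p : G →* Q}
    (hp : Function.Surjective p)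
    (τ : Q →* Equiv.Perm α) {c : G → α → Kˣ}
    (hc : ∀ g h x, c (g * h) x = c g (τ (p h) x) * c h x)
    (hne : ∀ x y, x ≠ y → ∃ n, p n = 1 ∧ c n x ≠ c n y)
    (hcard : Nat.card G = Nat.card α * Nat.card Q) (hK : (Nat.card p.ker : K) ≠ 0) :
    ∃ Φ : MonoidAlgebra K G →ₐ[K] Matrix α α (MonoidAlgebra K Q), Function.Injective Φ ∧
      Subalgebra.toSubmodule Φ.range = Submodule.span K (Set.range (crossedBasis K τ)) := by
  have := Fintype.ofFinite G
  have := Fintype.ofFinite Q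
  have := Fintype.ofFinite p.ker
  have hc1 (x : α) : c 1 x = 1 := by
    have := hc 1 1 x
    rw [mul_one, map_one, map_one, Equiv.Perm.one_apply] at this
    exact left_eq_mul.1 this
  let Φ₀ : G →* Matrix α α (MonoidAlgebra K Q) :=
    { toFun := fun g => ∑ x, (c g x : K) • crossedBasis K τ (x, p g)
      map_one' := by
        simp only [hc1, map_one, crossedBasis, Units.val_one, one_smul, Equiv.Perm.one_apply]
        ext a b : 1
        simp [Matrix.sum_apply, Matrix.single_apply, Matrix.one_apply, MonoidAlgebra.one_def,
          ite_and]
      map_mul' := fun g h => by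
        simp only [Finset.sum_mul, Finset.mul_sum, smul_mul_smul_comm, crossedBasis_mul, smul_ite,
          smul_zero]
        refine Finset.sum_congr rfl fun y _ => ?_
        simp [hc, Units.val_mul, map_mul] }
  let Φ := MonoidAlgebra.lift K _ G Φ₀
  have hΦ (g : G) : Φ (MonoidAlgebra.single g 1) = ∑ x, (c g x : K) • crossedBasis K τ (x, p g) := by
    simp [Φ, Φ₀]
  let χ (x : α) : p.ker →* Kˣ :=
    { toFun := fun n => c n x
      map_one' := hc1 x
      map_mul' := fun m n => by
        have hn : p n = 1 := n.2
        rw [Subgroup.coe_mul, hc, hn, map_one, Equiv.Perm.one_apply] }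
  have hχ (x y : α) : ∑ n : p.ker, (χ x n : K)⁻¹ * χ y n =
      if y = x then (Nat.card p.ker : K) else 0 := by
    split_ifs with h
    · rw [h, Nat.card_eq_fintype_card, Fintype.card_eq_sum_ones]
      simp only [ne_eq, Units.ne_zero, not_false_eq_true, inv_mul_cancel₀, Nat.cast_sum,
        Nat.cast_one]
    · refine sum_cocycle_kernel_eq_zero _ _ fun he => ?_
      obtain ⟨n, hn, hn'⟩ := hne y x h
      exact hn' (DFunLike.congr_fun he ⟨n, hn⟩)
  have hrange : Subalgebra.toSubmodule Φ.range =
      Submodule.span K (Set.range (crossedBasis K τ)) := by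
    apply le_antisymm
    · rintro _ ⟨a, rfl⟩
      induction a using MonoidAlgebra.induction_linear with
      | zero => simp
      | add a b ha hb =>
        rw [map_add]
        exact add_mem ha hb
      | single g r =>
        rw [← mul_one r, ← smul_eq_mul, ← MonoidAlgebra.smul_single]
        have h1 : Φ (r • MonoidAlgebra.single g 1) = r • Φ (MonoidAlgebra.single g 1) :=
          map_smul Φ _ _
        change Φ _ ∈ _
        rw [h1, hΦ]
        exact Submodule.smul_mem _ _ (Submodule.sum_mem _ fun x _ => Submodule.smul_mem _ _
          (Submodule.subset_span ⟨_, rfl⟩))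
    · rw [Submodule.span_le]
      rintro _ ⟨⟨x, h⟩, rfl⟩
      obtain ⟨g, rfl⟩ := hp h
      have : ∑ n : p.ker, (χ x n : K)⁻¹ • Φ (MonoidAlgebra.single (g * n) 1) =
          ((Nat.card p.ker : K) * c g x) • crossedBasis K τ (x, p g) := by
        have h1 (n : p.ker) : Φ (MonoidAlgebra.single (g * n) 1) =
            ∑ y, ((c g y : K) * χ y n) • crossedBasis K τ (y, p g) := by
          have hn : p n = 1 := n.2
          rw [hΦ]
          refine Finset.sum_congr rfl fun y _ => ?_
          rw [hc, map_mul, hn, mul_one, map_one, Equiv.Perm.one_apply, Units.val_mul]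
          rfl
        simp only [h1, Finset.smul_sum]
        rw [Finset.sum_comm]
        have h2 (y : α) : ∑ n : p.ker, (χ x n : K)⁻¹ •
            ((c g y : K) * χ y n) • crossedBasis K τ (y, p g) =
            (if y = x then ((Nat.card p.ker : K) * c g x) • crossedBasis K τ (x, p g) else 0) := by
          simp only [smul_smul, ← Finset.sum_smul]
          have h3 : ∑ n : p.ker, (χ x n : K)⁻¹ * ((c g y : K) * χ y n) =
              (if y = x then (Nat.card p.ker : K) else 0) * c g y := by
            rw [← hχ, Finset.sum_mul]
            exact Finset.sum_congr rfl fun n _ => by ring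
          rw [h3]
          split_ifs with h
          · rw [h]
          · rw [zero_mul, zero_smul]
        simp only [h2, Finset.sum_ite_eq', Finset.mem_univ, if_true]
      rw [SetLike.mem_coe, ← Submodule.smul_mem_iff _ (mul_ne_zero hK (c g x).ne_zero), ← this]
      exact Submodule.sum_mem _ fun n _ => Submodule.smul_mem _ _ ⟨_, rfl⟩
  refine ⟨Φ, ?_, hrange⟩
  have hfin : Module.finrank K (LinearMap.range Φ.toLinearMap) =
      Module.finrank K (MonoidAlgebra K G) := by
    have h1 : LinearMap.range Φ.toLinearMap =
      Submodule.span K (Set.range (crossedBasis K τ)) := hrange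
    rw [h1, finrank_span_eq_card (linearIndependent_crossedBasis τ), Fintype.card_prod,
      (MonoidAlgebra.coeffLinearEquiv K).finrank_eq, Module.finrank_finsupp_self,
      ← Nat.card_eq_fintype_card, ← Nat.card_eq_fintype_card, ← Nat.card_eq_fintype_card, hcard]
  have := LinearMap.finrank_range_add_finrank_ker Φ.toLinearMap
  rw [hfin, Nat.add_eq_left] at this
  exact LinearMap.ker_eq_bot.1 (Submodule.finrank_eq_zero.1 this)

end Cocycle

section GroupAlgebra

variable {A k ι K : Type*} [CommRing A] [Field k] [Fintype ι] [DecidableEq ι] [Field K]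
  {ρ : A →+* k} {π : A}

/-- The action of `GL ι k` on matrices by conjugation. -/
def conjPerm (ι k : Type*) [Field k] [Fintype ι] [DecidableEq ι] :
    GL ι k →* Equiv.Perm (Matrix ι ι k) :=
  (MulAction.toPermHom (ConjAct (GL ι k)) (Matrix ι ι k)).comp ConjAct.toConjAct.toMonoidHom

lemma conjPerm_apply (g : GL ι k) (X : Matrix ι ι k) :
    conjPerm ι k g X = (g : Matrix ι ι k) * X * ((g⁻¹ : GL ι k) : Matrix ι ι k) :=
  rfl

lemma conjPerm_eq_self_iff {g : GL ι k} {X : Matrix ι ι k} :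
    conjPerm ι k g X = X ↔ Commute (g : Matrix ι ι k) X := by
  rw [conjPerm_apply, Units.mul_inv_eq_iff_eq_mul]
  rfl

lemma val_map_eq (g : GL ι A) :
    (Matrix.GeneralLinearGroup.map ρ g : Matrix ι ι k) = ρ.mapMatrix (g : Matrix ι ι A) :=
  rfl

lemma natCard_matrix (ι R : Type*) [Finite ι] :
    Nat.card (Matrix ι ι R) = Nat.card R ^ (Nat.card ι * Nat.card ι) := by
  rw [Nat.card_congr Matrix.of.symm, Nat.card_fun, Nat.card_fun, ← pow_mul]

namespace IsLengthTwoReduction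

variable (hρ : IsLengthTwoReduction ρ π)
include hρ

lemma map_surjective : Function.Surjective (Matrix.GeneralLinearGroup.map (n := ι) ρ) := by
  intro u
  obtain ⟨Z, hZ⟩ := mapMatrix_surjective (ι := ι) hρ.surjective (u : Matrix ι ι k)
  obtain ⟨g, rfl⟩ := hρ.isUnit_matrix (by rw [hZ]; exact u.isUnit)
  exact ⟨g, Units.ext hZ⟩

lemma card_ker_map [Finite A] (hcard : Nat.card A = Nat.card k ^ 2) :
    Nat.card (Matrix.GeneralLinearGroup.map (n := ι) ρ).ker = Nat.card (Matrix ι ι k) := by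
  have : Finite k := Finite.of_surjective ρ hρ.surjective
  let F : Matrix ι ι A →+ Matrix ι ι k := (ρ.mapMatrix (m := ι)).toAddMonoidHom
  have hF : Function.Surjective F := mapMatrix_surjective hρ.surjective
  have e : (Matrix.GeneralLinearGroup.map (n := ι) ρ).ker ≃ F.ker := by
    refine Equiv.ofBijective (fun g => ⟨(g : GL ι A) - 1, ?_⟩) ⟨fun g h hgh => ?_, fun M => ?_⟩
    · have := congrArg Units.val g.2
      rw [val_map_eq] at this
      change ρ.mapMatrix _ = 0
      rw [map_sub, this, map_one]
      exact sub_self _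
    · exact Subtype.ext (Units.ext (sub_left_injective (congrArg Subtype.val hgh)))
    · have hM : ρ.mapMatrix (1 + M.1) = 1 := by
        rw [map_add, map_one, show ρ.mapMatrix M.1 = 0 from M.2, add_zero]
      obtain ⟨g, hg⟩ := hρ.isUnit_matrix (Z := 1 + M.1) (by rw [hM]; exact isUnit_one)
      refine ⟨⟨g, Units.ext ?_⟩, Subtype.ext ?_⟩
      · rw [val_map_eq, hg, hM]; rfl
      · simp [hg]
  have h1 := AddSubgroup.card_eq_card_quotient_mul_card_addSubgroup F.ker
  rw [Nat.card_congr (QuotientAddGroup.quotientKerEquivOfSurjective F hF).toEquiv,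
    ← Nat.card_congr e] at h1
  have h2 : Nat.card (Matrix ι ι A) = Nat.card (Matrix ι ι k) * Nat.card (Matrix ι ι k) := by
    rw [natCard_matrix, natCard_matrix, hcard]
    ring
  exact (Nat.mul_left_cancel Nat.card_pos (h2.symm.trans h1)).symm

lemma exists_trace_mul_eq {Y Y' : Matrix ι ι A} (h : ρ.mapMatrix Y ≠ ρ.mapMatrix Y') :
    ∃ M : Matrix ι ι A, ρ.mapMatrix M = 0 ∧ (Y * M).trace = π + (Y' * M).trace := by
  obtain ⟨i, j, hij⟩ : ∃ i j, ρ (Y i j) ≠ ρ (Y' i j) := by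
    by_contra! hc
    exact h (Matrix.ext hc)
  obtain ⟨z, hz⟩ := hρ.isUnit_of_map_ne_zero (x := Y i j - Y' i j)
    (by rwa [map_sub, sub_ne_zero])
  refine ⟨Matrix.single j i ((z⁻¹ : Aˣ) * π), ?_, ?_⟩
  · ext a b
    simp only [RingHom.mapMatrix_apply, Matrix.map_apply, Matrix.single_apply, Matrix.zero_apply]
    split_ifs <;> simp [hρ.map_generator]
  · rw [Matrix.trace_mul_single, Matrix.trace_mul_single, ← sub_eq_iff_eq_add]
    rw [← smul_sub, ← hz, op_smul_eq_mul, Units.mul_inv_cancel_left]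

theorem exists_groupAlgebra_embedding [Finite A] [Fintype k] [DecidableEq k] {ω : AddChar A Kˣ}
    (hω : ω π ≠ 1) (hcard : Nat.card A = Nat.card k ^ 2) (hK : (Nat.card k : K) ≠ 0) :
    ∃ Φ : MonoidAlgebra K (GL ι A) →ₐ[K]
        Matrix (Matrix ι ι k) (Matrix ι ι k) (MonoidAlgebra K (GL ι k)),
      Function.Injective Φ ∧ Subalgebra.toSubmodule Φ.range =
        Submodule.span K (Set.range (crossedBasis K (conjPerm ι k))) := by
  choose f hf hf' using fun X : Matrix ι ι k => hρ.kernelCharExtends ω X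
  let p : GL ι A →* GL ι k := Matrix.GeneralLinearGroup.map ρ
  have hstab (X : Matrix ι ι k) (g h : GL ι A) (hg : conjPerm ι k (p g) X = X)
      (hh : conjPerm ι k (p h) X = X) : f X (g * h) = f X g * f X h :=
    hf X g h (conjPerm_eq_self_iff.1 hg) (conjPerm_eq_self_iff.1 hh)
  obtain ⟨c, hc, hcx⟩ := exists_cocycle_of_stabilizer ((conjPerm ι k).comp p) f hstab
  have hker (Y : Matrix ι ι A) (n : GL ι A) (hn : p n = 1) :
      c n (ρ.mapMatrix Y) = ω (Y * (n - 1 : Matrix ι ι A)).trace := by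
    obtain ⟨X₀, γ, hγ, h⟩ := hcx (ρ.mapMatrix Y)
    obtain ⟨Y₀, rfl⟩ := mapMatrix_surjective hρ.surjective X₀
    have hn' : ρ.mapMatrix (n : Matrix ι ι A) = 1 := congrArg Units.val hn
    rw [h n (by rw [MonoidHom.comp_apply, hn, map_one]; rfl), hf' _ Y₀ _ rfl]
    · have h1 : Y₀ * (((γ⁻¹ * n * γ : GL ι A) : Matrix ι ι A) - 1) =
          Y₀ * ((γ⁻¹ : GL ι A) : Matrix ι ι A) * (n - 1 : Matrix ι ι A) * γ := by
        simp only [Units.val_mul, mul_sub, sub_mul, mul_assoc, mul_one, Units.inv_mul]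
      rw [h1, Matrix.trace_mul_comm, ← mul_assoc, ← mul_assoc]
      congr 2
      refine mul_eq_mul_of_map_eq hρ.mul_eq_zero ?_ (by rw [map_sub, hn', map_one, sub_self])
      rw [← hγ, map_mul, map_mul]
      rfl
    · have : p (γ⁻¹ * n * γ) = 1 := by rw [map_mul, map_mul, hn, mul_one, ← map_mul]; simp
      exact congrArg Units.val this
  refine exists_injective_range_eq_span_crossedBasis hρ.map_surjective (conjPerm ι k) hc
    (fun X X' hne => ?_) ?_ ?_
  · obtain ⟨Y, rfl⟩ := mapMatrix_surjective hρ.surjective X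
    obtain ⟨Y', rfl⟩ := mapMatrix_surjective hρ.surjective X'
    obtain ⟨M, hM, htr⟩ := hρ.exists_trace_mul_eq hne
    have hM1 : ρ.mapMatrix (1 + M : Matrix ι ι A) = 1 := by rw [map_add, map_one, hM, add_zero]
    obtain ⟨n, hn⟩ := hρ.isUnit_matrix (Z := 1 + M) (by rw [hM1]; exact isUnit_one)
    have hpn : p n = 1 := Units.ext (by rw [val_map_eq, hn, hM1]; rfl)
    refine ⟨n, hpn, ?_⟩
    rw [hker Y n hpn, hker Y' n hpn, hn, add_sub_cancel_left, htr, AddChar.map_add_eq_mul]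
    simpa using hω
  · rw [Subgroup.card_eq_card_quotient_mul_card_subgroup p.ker,
      Nat.card_congr (QuotientGroup.quotientKerEquivOfSurjective p hρ.map_surjective).toEquiv,
      hρ.card_ker_map hcard, mul_comm]
  · rw [hρ.card_ker_map hcard, natCard_matrix, Nat.cast_pow]
    exact pow_ne_zero _ hK

end IsLengthTwoReduction

end GroupAlgebra

section LocalRing

variable {A : Type*} [CommRing A] [IsLocalRing A] [Finite A]

open IsLocalRing in
lemma exists_isLengthTwoReduction_residue (hm : maximalIdeal A ^ 2 = ⊥)
    (hcard : Nat.card A = Nat.card (ResidueField A) ^ 2) :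
    ∃ π, π ≠ 0 ∧ IsLengthTwoReduction (residue A) π := by
  have : Finite (ResidueField A) := Finite.of_surjective _ residue_surjective
  have hq : 1 < Nat.card (ResidueField A) := Finite.one_lt_card
  have hcm : Nat.card (maximalIdeal A) = Nat.card (ResidueField A) := by
    have h := Submodule.card_eq_card_quotient_mul_card (maximalIdeal A)
    rw [hcard, pow_two] at h
    exact (Nat.mul_right_cancel (m := Nat.card (ResidueField A)) (by omega) h).symm
  have : Nontrivial (maximalIdeal A) := Finite.one_lt_card_iff_nontrivial.1 (hcm ▸ hq)
  obtain ⟨⟨π, hπ⟩, hπ0⟩ := exists_ne (0 : maximalIdeal A)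
  have hπ0 : π ≠ 0 := fun h => hπ0 (Subtype.ext h)
  have hsq (x y : A) (hx : x ∈ maximalIdeal A) (hy : y ∈ maximalIdeal A) : x * y = 0 := by
    have := Ideal.mul_mem_mul hx hy
    rwa [← pow_two, hm] at this
  have hann (y : A) : π * y = 0 ↔ y ∈ maximalIdeal A := by
    refine ⟨fun h => ?_, hsq π y hπ⟩
    by_contra hy
    rw [mem_maximalIdeal, mem_nonunits_iff, not_not] at hy
    exact hπ0 (hy.mul_left_eq_zero.1 h)
  refine ⟨π, hπ0, residue_surjective, fun x y hx hy => hsq x y ((residue_eq_zero_iff x).1 hx)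
    ((residue_eq_zero_iff y).1 hy), (residue_eq_zero_iff π).2 hπ, fun x hx => ?_,
    fun y hy => (residue_eq_zero_iff y).2 ((hann y).1 hy)⟩
  let F : A →+ A := AddMonoidHom.mulLeft π
  have hker : F.ker = (maximalIdeal A).toAddSubgroup := AddSubgroup.ext hann
  have hle : F.range ≤ (maximalIdeal A).toAddSubgroup := by
    rintro _ ⟨y, rfl⟩
    exact Ideal.mul_mem_right y _ hπ
  have h := AddSubgroup.card_eq_card_quotient_mul_card_addSubgroup F.ker
  rw [Nat.card_congr (QuotientAddGroup.quotientKerEquivRange F).toEquiv, hker] at h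
  have hcm' : Nat.card (maximalIdeal A).toAddSubgroup = Nat.card (ResidueField A) := hcm
  rw [hcm', hcard, pow_two] at h
  have hx' : x ∈ F.range := by
    rw [AddSubgroup.eq_of_le_of_card_ge hle
      (by rw [hcm', Nat.mul_right_cancel (by omega) h])]
    exact (residue_eq_zero_iff x).1 hx
  exact hx'

lemma IsLengthTwoReduction.comp_equiv {A k k' : Type*} [CommRing A] [Field k] [Field k']
    {ρ : A →+* k} {π : A} (hρ : IsLengthTwoReduction ρ π) (e : k ≃+* k') :
    IsLengthTwoReduction ((e : k →+* k').comp ρ) π where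
  surjective := e.surjective.comp hρ.surjective
  mul_eq_zero x y hx hy := hρ.mul_eq_zero x y (by simpa using hx) (by simpa using hy)
  map_generator := by simp [hρ.map_generator]
  exists_mul_eq x hx := hρ.exists_mul_eq x (by simpa using hx)
  map_eq_zero_of_mul y hy := by simp [hρ.map_eq_zero_of_mul y hy]

omit [IsLocalRing A] in
lemma exists_addChar_ne_one {K : Type*} [Field K] [IsAlgClosed K] (hK : (Nat.card A : K) ≠ 0)
    {π : A} (hπ : π ≠ 0) : ∃ ω : AddChar A Kˣ, ω π ≠ 1 := by
  have : NeZero (Monoid.exponent (Multiplicative A) : K) := ⟨fun h => hK <| by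
    obtain ⟨c, hc⟩ := Group.exponent_dvd_nat_card (G := Multiplicative A)
    rw [← Nat.card_congr Multiplicative.toAdd, hc, Nat.cast_mul, h, zero_mul]⟩
  obtain ⟨φ, hφ⟩ := CommGroup.exists_apply_ne_one_of_hasEnoughRootsOfUnity (Multiplicative A) K
    (a := Multiplicative.ofAdd π) (by simpa using hπ)
  exact ⟨AddChar.toMonoidHomEquiv.symm φ, hφ⟩

end LocalRing

/-- **Theorem 5.4 for `GLₙ`.** If `A` and `A'` are finite commutative local rings of
length two with residue field of cardinality `q = p ^ d`, and `K` is an algebraically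
closed field of characteristic different from `p`, then the group algebras
`K[GLₙ(A)]` and `K[GLₙ(A')]` are isomorphic as `K`-algebras. -/
theorem group_algebra_iso_GL_of_length_two_local_rings
    (p d n : ℕ) (hp : p.Prime) (hd : 1 ≤ d) (hn : 1 ≤ n) (q : ℕ) (hq : q = p ^ d)
    (K : Type*) [Field K] [IsAlgClosed K] (hK : ringChar K ≠ p)
    (A A' : Type*) [CommRing A] [CommRing A'] [IsLocalRing A] [IsLocalRing A']
    [Fintype A] [Fintype A']
    (hm : (IsLocalRing.maximalIdeal A) ^ 2 = ⊥)
    (hm' : (IsLocalRing.maximalIdeal A') ^ 2 = ⊥)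
    (hres : Nat.card (A ⧸ IsLocalRing.maximalIdeal A) = q)
    (hres' : Nat.card (A' ⧸ IsLocalRing.maximalIdeal A') = q)
    (hcard : Nat.card A = q ^ 2) (hcard' : Nat.card A' = q ^ 2) :
    Nonempty (MonoidAlgebra K (GL (Fin n) A) ≃ₐ[K] MonoidAlgebra K (GL (Fin n) A')) := by
  classical
  have hqK : (q : K) ≠ 0 := by
    rw [hq, Nat.cast_pow]
    exact pow_ne_zero _ fun h => hK
      (((Nat.dvd_prime hp).1 (ringChar.dvd h)).resolve_left CharP.ringChar_ne_one)
  have hk : Nat.card (IsLocalRing.ResidueField A) = q := hres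
  have hk' : Nat.card (IsLocalRing.ResidueField A') = q := hres'
  have : Finite (IsLocalRing.ResidueField A) :=
    Finite.of_surjective _ IsLocalRing.residue_surjective
  have : Finite (IsLocalRing.ResidueField A') :=
    Finite.of_surjective _ IsLocalRing.residue_surjective
  have := Fintype.ofFinite (IsLocalRing.ResidueField A)
  have := Fintype.ofFinite (IsLocalRing.ResidueField A')
  have e : IsLocalRing.ResidueField A' ≃+* IsLocalRing.ResidueField A :=
    FiniteField.ringEquivOfCardEq (by
      rw [← Nat.card_eq_fintype_card, ← Nat.card_eq_fintype_card, hk, hk'])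
  obtain ⟨π, hπ, hρ⟩ := exists_isLengthTwoReduction_residue hm (by rw [hcard, hk])
  obtain ⟨π', hπ', hρ'⟩ := exists_isLengthTwoReduction_residue hm' (by rw [hcard', hk'])
  obtain ⟨ω, hω⟩ := exists_addChar_ne_one (K := K)
    (by rw [hcard, Nat.cast_pow]; exact pow_ne_zero 2 hqK) hπ
  obtain ⟨ω', hω'⟩ := exists_addChar_ne_one (K := K)
    (by rw [hcard', Nat.cast_pow]; exact pow_ne_zero 2 hqK) hπ'
  obtain ⟨Φ, hΦ, hr⟩ := hρ.exists_groupAlgebra_embedding (ι := Fin n) hω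
    (by rw [hcard, hk]) (by rwa [hk])
  obtain ⟨Φ', hΦ', hr'⟩ := (hρ'.comp_equiv e).exists_groupAlgebra_embedding (ι := Fin n) hω'
    (by rw [hcard', hk]) (by rwa [hk])
  exact ⟨(AlgEquiv.ofInjective Φ hΦ).trans ((Subalgebra.equivOfEq _ _
    (Subalgebra.toSubmodule_injective (hr.trans hr'.symm))).trans
      (AlgEquiv.ofInjective Φ' hΦ').symm)⟩
end

section
/- Let p be a prime, d ≥ 1, q = p^d, and n ≥ 1 with p not dividing n. Let K be an algebraically closed field with char K ≠ p. Then there is a K-algebra isomorphism between the group algebras K[SL_n(𝔽_q[t]/t²)] and K[SL_n(W₂(𝔽_q))], where SL_n denotes the special linear group (matrices of determinant 1), 𝔽_q[t]/t² is the ring of dual numbers DualNumber (GaloisField p d), and W₂(𝔽_q) = TruncatedWittVector p 2 (GaloisField p d) is the ring of Witt vectors of length two. -/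
open Matrix

/-- A symmetric nondegenerate pairing on a finite abelian group `V`, with values in the
multiplicative monoid of `K` and invariant under the action of `Q`. -/
structure InvariantPairing (K Q V : Type*) [Field K] [Group Q] [AddCommGroup V] [Fintype V]
    [DistribMulAction Q V] where
  toFun : V → V → K
  zero_right : ∀ a, toFun a 0 = 1
  add_right : ∀ a v w, toFun a (v + w) = toFun a v * toFun a w
  symm : ∀ a v, toFun a v = toFun v a
  smul_smul : ∀ (q : Q) a v, toFun (q • a) (q • v) = toFun a v
  sum_eq_zero : ∀ a, a ≠ 0 → ∑ v, toFun a v = 0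
  card_ne_zero : (Fintype.card V : K) ≠ 0

/-- An extension `E` of `Q` by `V` together with a multiplicative cocycle on the action groupoid
of `E` on `V` which restricts to the given pairing on `V`. -/
structure SplitExtension {K Q V : Type*} [Field K] [Group Q] [AddCommGroup V] [Fintype V]
    [DistribMulAction Q V] (c : InvariantPairing K Q V) (E : Type*) [Group E] where
  proj : E →* Q
  proj_surjective : Function.Surjective proj
  incl : V → E
  incl_add : ∀ v w, incl (v + w) = incl v * incl w
  proj_incl : ∀ v, proj (incl v) = 1
  exists_incl_eq : ∀ g, proj g = 1 → ∃ v, incl v = g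
  mul_incl : ∀ g v, g * incl v = incl (proj g • v) * g
  cocycle : E → V → Kˣ
  cocycle_mul : ∀ g h a, cocycle (g * h) a = cocycle g (proj h • a) * cocycle h a
  cocycle_incl : ∀ v a, (cocycle (incl v) a : K) = c.toFun a v

/-- A system of elements of a ring multiplying like the arrows of the action groupoid of `Q`
on `V`. -/
structure GroupoidUnits (Q V B : Type*) [Group Q] [Fintype V] [MulAction Q V] [Ring B] where
  toFun : Q → V → B
  mul_of_eq : ∀ q r a, toFun q (r • a) * toFun r a = toFun (q * r) a
  mul_of_ne : ∀ q r a b, a ≠ r • b → toFun q a * toFun r b = 0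
  sum_one : ∑ a, toFun 1 a = 1

namespace SplitExtension

open MonoidAlgebra

variable {K Q V E : Type*} [Field K] [Group Q] [AddCommGroup V] [Fintype V]
    [DistribMulAction Q V] {c : InvariantPairing K Q V} [Group E] (X : SplitExtension c E)

theorem _root_.InvariantPairing.neg_mul_self (c : InvariantPairing K Q V) (a v : V) :
    c.toFun a (-v) * c.toFun a v = 1 := by
  rw [← c.add_right, neg_add_cancel, c.zero_right]

theorem _root_.InvariantPairing.neg_right_eq_neg_left (c : InvariantPairing K Q V) (a v : V) :
    c.toFun a (-v) = c.toFun (-a) v := by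
  have h1 := c.neg_mul_self a v
  have h2 := c.neg_mul_self v a
  rw [c.symm v (-a), c.symm v a] at h2
  exact mul_right_cancel₀ (right_ne_zero_of_mul_eq_one h1) (h1.trans h2.symm)

theorem incl_zero : X.incl 0 = 1 := by
  have := X.incl_add 0 0
  rwa [add_zero, left_eq_mul] at this

theorem cocycle_one (a : V) : X.cocycle 1 a = 1 := by
  have := X.cocycle_mul 1 1 a
  rwa [mul_one, map_one, one_smul, left_eq_mul] at this

/-- The idempotent of the group algebra attached to the character of `V` given by `a`. -/
noncomputable def idem (a : V) : MonoidAlgebra K E :=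
  (Fintype.card V : K)⁻¹ • ∑ v, c.toFun a (-v) • of K E (X.incl v)

theorem of_incl_mul_idem (a w : V) :
    of K E (X.incl w) * X.idem a = c.toFun a w • X.idem a := by
  rw [idem, mul_smul_comm, smul_comm (c.toFun a w), Finset.mul_sum,
    Finset.smul_sum (r := c.toFun a w)]
  congr 1
  refine Fintype.sum_equiv (Equiv.addLeft w) _ _ fun v => ?_
  simp only [Equiv.coe_addLeft]
  rw [mul_smul_comm, ← map_mul, ← X.incl_add, smul_smul, ← c.add_right]
  congr 2
  abel

theorem idem_mul_self (a : V) : X.idem a * X.idem a = X.idem a := by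
  conv_lhs => enter [1]; rw [idem]
  rw [smul_mul_assoc, Finset.sum_mul]
  simp_rw [smul_mul_assoc, of_incl_mul_idem, smul_smul, c.neg_mul_self, one_smul]
  rw [Finset.sum_const, Finset.card_univ, ← Nat.cast_smul_eq_nsmul K, smul_smul,
    inv_mul_cancel₀ c.card_ne_zero, one_smul]

theorem idem_mul_of_ne {a b : V} (h : a ≠ b) : X.idem a * X.idem b = 0 := by
  conv_lhs => enter [1]; rw [idem]
  rw [smul_mul_assoc, Finset.sum_mul]
  simp_rw [smul_mul_assoc, of_incl_mul_idem, smul_smul]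
  rw [← Finset.sum_smul]
  have : ∑ v, c.toFun a (-v) * c.toFun b v = 0 := by
    rw [← c.sum_eq_zero (b - a) (sub_ne_zero.2 h.symm)]
    refine Finset.sum_congr rfl fun v _ => ?_
    rw [c.neg_right_eq_neg_left, c.symm _ v, c.symm _ v, c.symm _ v, ← c.add_right]
    congr 1
    abel
  rw [this, zero_smul, smul_zero]

theorem sum_idem : ∑ a, X.idem a = 1 := by
  classical
  simp_rw [idem]
  rw [← Finset.smul_sum, Finset.sum_comm]
  simp_rw [← Finset.sum_smul]
  rw [Finset.sum_eq_single (0 : V)]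
  · simp_rw [neg_zero, c.zero_right]
    rw [Finset.sum_const, Finset.card_univ, nsmul_eq_mul, mul_one, smul_smul,
      inv_mul_cancel₀ c.card_ne_zero, one_smul, X.incl_zero, map_one]
  · intro v _ hv
    simp_rw [c.symm _ (-v)]
    rw [c.sum_eq_zero _ (neg_ne_zero.2 hv), zero_smul]
  · simp

theorem of_mul_idem (g : E) (a : V) :
    of K E g * X.idem a = X.idem (X.proj g • a) * of K E g := by
  rw [idem, idem, mul_smul_comm, smul_mul_assoc, Finset.mul_sum, Finset.sum_mul]
  congr 1
  refine Fintype.sum_equiv (MulAction.toPerm (X.proj g)) _ _ fun v => ?_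
  simp only [MulAction.toPerm_apply]
  rw [mul_smul_comm, smul_mul_assoc, ← map_mul, ← map_mul, X.mul_incl, ← smul_neg, c.smul_smul]

/-- The arrows of the action groupoid inside the group algebra of a split extension. -/
noncomputable def unit (q : Q) (a : V) : MonoidAlgebra K E :=
  (X.cocycle (Function.surjInv X.proj_surjective q) a : K)⁻¹ •
    (of K E (Function.surjInv X.proj_surjective q) * X.idem a)

theorem of_mul_idem_eq_smul_unit (g : E) (a : V) :
    of K E g * X.idem a = (X.cocycle g a : K) • X.unit (X.proj g) a := by
  rw [unit]
  set s := Function.surjInv X.proj_surjective (X.proj g) with hs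
  have hsg : X.proj s = X.proj g := Function.surjInv_eq X.proj_surjective (X.proj g)
  obtain ⟨v, hv⟩ := X.exists_incl_eq (s⁻¹ * g) (by rw [map_mul, map_inv, hsg, inv_mul_cancel])
  have hg : g = s * X.incl v := by rw [hv, mul_inv_cancel_left]
  have hc : (X.cocycle g a : K) = X.cocycle s a * c.toFun a v := by
    rw [hg, X.cocycle_mul, Units.val_mul, X.cocycle_incl, X.proj_incl, one_smul]
  rw [hc, smul_smul, mul_comm, inv_mul_cancel_left₀ (Units.ne_zero _)]
  conv_lhs => rw [hg]
  rw [map_mul, mul_assoc, X.of_incl_mul_idem, mul_smul_comm]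

theorem unit_eq (g : E) (a : V) :
    X.unit (X.proj g) a = (X.cocycle g a : K)⁻¹ • (of K E g * X.idem a) := by
  rw [of_mul_idem_eq_smul_unit, inv_smul_smul₀ (Units.ne_zero _)]

theorem unit_one (a : V) : X.unit 1 a = X.idem a := by
  have := X.unit_eq 1 a
  rwa [map_one, X.cocycle_one, Units.val_one, inv_one, one_smul, map_one, one_mul] at this

/-- The groupoid units of the group algebra of a split extension. -/
noncomputable def units : GroupoidUnits Q V (MonoidAlgebra K E) where
  toFun := X.unit
  mul_of_eq q r a := by
    obtain ⟨g, rfl⟩ := X.proj_surjective q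
    obtain ⟨h, rfl⟩ := X.proj_surjective r
    rw [← map_mul, unit_eq, unit_eq, unit_eq, smul_mul_smul_comm, X.cocycle_mul, Units.val_mul,
      mul_inv]
    congr 1
    rw [map_mul, mul_assoc, ← mul_assoc (X.idem _), ← X.of_mul_idem, mul_assoc (of K E h),
      X.idem_mul_self, mul_assoc]
  mul_of_ne q r a b hab := by
    obtain ⟨g, rfl⟩ := X.proj_surjective q
    obtain ⟨h, rfl⟩ := X.proj_surjective r
    rw [unit_eq, unit_eq, smul_mul_smul_comm, X.of_mul_idem h, mul_assoc, ← mul_assoc (X.idem _),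
      X.idem_mul_of_ne hab, zero_mul, mul_zero, smul_zero]
  sum_one := by simp_rw [unit_one, sum_idem]

theorem of_eq_sum (g : E) : of K E g = ∑ a, (X.cocycle g a : K) • X.unit (X.proj g) a := by
  simp_rw [← of_mul_idem_eq_smul_unit]
  rw [← Finset.mul_sum, sum_idem, mul_one]

variable {B : Type*} [Ring B] [Algebra K B] (U : GroupoidUnits Q V B)

/-- The algebra homomorphism out of the group algebra of a split extension determined by a
system of groupoid units. -/
noncomputable def lift : MonoidAlgebra K E →ₐ[K] B :=
  MonoidAlgebra.lift K B E
    { toFun := fun g => ∑ a, (X.cocycle g a : K) • U.toFun (X.proj g) a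
      map_one' := by simp_rw [X.cocycle_one, map_one, Units.val_one, one_smul, U.sum_one]
      map_mul' := fun g h => by
        rw [Finset.sum_mul_sum, Finset.sum_comm]
        refine Finset.sum_congr rfl fun a _ => ?_
        rw [Finset.sum_eq_single (X.proj h • a)]
        · rw [smul_mul_smul_comm, U.mul_of_eq, map_mul, X.cocycle_mul, Units.val_mul]
        · intro b _ hb
          rw [smul_mul_smul_comm, U.mul_of_ne _ _ _ _ hb, smul_zero]
        · simp }

theorem lift_of (g : E) :
    X.lift U (of K E g) = ∑ a, (X.cocycle g a : K) • U.toFun (X.proj g) a := by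
  simp [lift]

theorem lift_idem (a : V) : X.lift U (X.idem a) = U.toFun 1 a := by
  rw [idem, _root_.map_smul, map_sum]
  simp_rw [_root_.map_smul, lift_of, X.proj_incl, X.cocycle_incl, Finset.smul_sum, smul_smul]
  rw [Finset.sum_comm]
  simp_rw [← Finset.sum_smul]
  rw [Finset.sum_eq_single a]
  · simp_rw [c.neg_mul_self]
    rw [Finset.sum_const, Finset.card_univ, nsmul_eq_mul, mul_one,
      mul_inv_cancel₀ c.card_ne_zero, one_smul]
  · intro b _ hb
    simp_rw [c.neg_right_eq_neg_left]
    rw [← Finset.mul_sum]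
    have : ∑ v, c.toFun (-a) v * c.toFun b v = 0 := by
      rw [← c.sum_eq_zero (b - a) (sub_ne_zero.2 hb)]
      refine Finset.sum_congr rfl fun v _ => ?_
      rw [c.symm _ v, c.symm _ v, c.symm _ v, ← c.add_right]
      congr 1
      abel
    rw [this, mul_zero, zero_smul]
  · simp

theorem lift_unit (q : Q) (a : V) : X.lift U (X.unit q a) = U.toFun q a := by
  obtain ⟨g, rfl⟩ := X.proj_surjective q
  rw [unit_eq, _root_.map_smul, map_mul, lift_idem, lift_of, Finset.sum_mul, Finset.sum_eq_single a]
  · have h := U.mul_of_eq (X.proj g) 1 a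
    rw [one_smul, mul_one] at h
    rw [smul_mul_assoc, h, inv_smul_smul₀ (Units.ne_zero _)]
  · intro b _ hb
    rw [smul_mul_assoc, U.mul_of_ne _ _ _ _ (by rwa [one_smul]), smul_zero]
  · simp

theorem lift_comp_lift {F : Type*} [Group F] (Y : SplitExtension c F) :
    (Y.lift X.units).comp (X.lift Y.units) = AlgHom.id K _ := by
  refine MonoidAlgebra.algHom_ext (fun g => ?_) (Subsingleton.elim _ _)
  change Y.lift X.units (X.lift Y.units (of K E g)) = of K E g
  rw [lift_of, map_sum, X.of_eq_sum]
  simp_rw [_root_.map_smul]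
  exact Finset.sum_congr rfl fun a _ => congrArg _ (Y.lift_unit X.units _ a)

/-- The group algebras of two split extensions of the same group by the same module are
isomorphic. -/
noncomputable def algEquiv {F : Type*} [Group F] (Y : SplitExtension c F) :
    MonoidAlgebra K E ≃ₐ[K] MonoidAlgebra K F :=
  AlgEquiv.ofAlgHom (X.lift Y.units) (Y.lift X.units) (Y.lift_comp_lift X) (X.lift_comp_lift Y)

end SplitExtension

/-- Homomorphisms on the stabilizers of an action, compatible with a family of characters of a
normal subgroup acting trivially, assemble to a cocycle on the action groupoid. -/
theorem exists_cocycle_of_stabilizer_hom {E V A : Type*} [Group E] [MulAction E V] [CommGroup A]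
    (N : Subgroup E) [N.Normal] (hNV : ∀ n ∈ N, ∀ x : V, n • x = x) (χ : V → E → A)
    (hχ : ∀ g x, ∀ n ∈ N, χ (g • x) n = χ x (g⁻¹ * n * g))
    (hf : ∀ x, ∃ f : MulAction.stabilizer E x →* A, ∀ n : MulAction.stabilizer E x,
      (n : E) ∈ N → f n = χ x n) :
    ∃ θ : E → V → A, (∀ g h x, θ (g * h) x = θ g (h • x) * θ h x) ∧
      ∀ n ∈ N, ∀ x, θ n x = χ x n := by
  classical
  choose f hf using hf
  let F : V → E → A := fun x g => if h : g • x = x then f x ⟨g, h⟩ else 1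
  have hFmul : ∀ x g h, g • x = x → h • x = x → F x (g * h) = F x g * F x h := by
    intro x g h hg hh
    have hgh : (g * h) • x = x := by rw [mul_smul, hh, hg]
    simp only [F, dif_pos hg, dif_pos hh, dif_pos hgh]
    rw [← map_mul]
    rfl
  have hFN : ∀ x, ∀ n ∈ N, F x n = χ x n := by
    intro x n hn
    simp only [F, dif_pos (hNV n hn x)]
    exact hf x _ hn
  let r : V → V := fun x => (Quotient.mk (MulAction.orbitRel E V) x).out
  have hr : ∀ g x, r (g • x) = r x := fun g x =>
    congrArg Quotient.out (Quotient.sound (MulAction.orbitRel_apply.2 ⟨g, rfl⟩))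
  have ht : ∀ x, ∃ t : E, t • r x = x := by
    intro x
    have : x ∈ MulAction.orbit E (r x) :=
      MulAction.orbitRel_apply.1 
        ((MulAction.orbitRel E V).symm' (Quotient.mk_out (s := MulAction.orbitRel E V) x))
    exact this
  choose t ht using ht
  have hstab : ∀ g x, ((t (g • x))⁻¹ * g * t x) • r x = r x := by
    intro g x
    rw [mul_smul, mul_smul, ht, inv_smul_eq_iff, ← hr g x, ht]
  refine ⟨fun g x => F (r x) ((t (g • x))⁻¹ * g * t x), fun g h x => ?_, fun n hn x => ?_⟩
  · beta_reduce
    rw [hr h x, ← hFmul _ _ _ (by rw [← hr h x]; exact hstab g (h • x)) (hstab h x), mul_smul]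
    congr 1
    group
  · beta_reduce
    rw [hNV n hn x]
    have hn' : (t x)⁻¹ * n * t x ∈ N := by
      simpa using ‹N.Normal›.conj_mem n hn (t x)⁻¹
    rw [hFN _ _ hn', ← hχ _ _ _ hn, ht]

/-- An invariant character of exponent `p` of a normal `p`-subgroup extends to the whole group as
soon as it extends to the `p`-subgroups containing it. -/
theorem exists_extension_of_isPGroup {p : ℕ} [Fact p.Prime] {H A : Type*} [Group H] [Finite H]
    [CommGroup A] (N : Subgroup H) [N.Normal] (hN : IsPGroup p N) (χ : H → A)
    (hχ : ∀ g, ∀ n ∈ N, χ (g⁻¹ * n * g) = χ n) (hpow : ∀ n ∈ N, χ n ^ p = 1)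
    (hext : ∀ P : Subgroup H, IsPGroup p P → N ≤ P →
      ∃ f : P →* A, ∀ n : P, (n : H) ∈ N → f n = χ n) :
    ∃ f : H →* A, ∀ n ∈ N, f n = χ n := by
  obtain ⟨P, hNP⟩ := hN.exists_le_sylow
  obtain ⟨f, hf⟩ := hext P P.isPGroup' hNP
  obtain ⟨k, -, hk⟩ := Nat.exists_mul_mod_eq_one_of_coprime
    (((Nat.Prime.coprime_iff_not_dvd Fact.out).2 P.not_dvd_index).symm) (Fact.out : p.Prime).one_lt
  refine ⟨(powMonoidHom k).comp f.transfer, fun n hn => ?_⟩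
  have htr : f.transfer n = χ n ^ (P : Subgroup H).index := by
    rw [MonoidHom.transfer_def f default, Subgroup.leftTransversals.diff]
    let _ := (P : Subgroup H).fintypeQuotientOfFiniteIndex
    have key : ∀ q : H ⧸ (P : Subgroup H), n⁻¹ • q = q := by
      intro q
      induction q using QuotientGroup.induction_on with | H g =>
      rw [MulAction.Quotient.smul_mk, QuotientGroup.eq]
      apply hNP
      simpa [mul_assoc] using ‹N.Normal›.conj_mem n hn g⁻¹
    rw [Finset.prod_congr rfl (g := fun _ => χ n), Finset.prod_const, Finset.card_univ,
      Subgroup.index_eq_card, Nat.card_eq_fintype_card]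
    intro q _
    rw [hf]
    · simp only [Subgroup.smul_apply_eq_smul_apply_inv_smul, key, smul_eq_mul, ← mul_assoc]
      exact hχ _ _ hn
    · simp only [Subgroup.smul_apply_eq_smul_apply_inv_smul, key, smul_eq_mul, ← mul_assoc]
      exact ‹N.Normal›.conj_mem' n hn _
  rw [MonoidHom.comp_apply, htr, powMonoidHom_apply, ← pow_mul, pow_eq_pow_mod _ (hpow n hn), hk,
    pow_one]

section

open Module

/-- A filtration of a vector space has an adapted linearly independent set. -/
theorem exists_linearIndepOn_adapted {k V : Type*} [DivisionRing k] [AddCommGroup V] [Module k V]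
    (F : ℕ → Submodule k V) (hF : Monotone F) (h0 : F 0 = ⊥) (l : ℕ) :
    ∃ s : Set V, LinearIndepOn k id s ∧ s ⊆ F l ∧
      ∀ i ≤ l, F i ≤ Submodule.span k (s ∩ F i) := by
  induction l with
  | zero =>
    refine ⟨∅, linearIndepOn_empty _ _, Set.empty_subset _, fun i hi => ?_⟩
    rw [Nat.le_zero.1 hi, h0]
    exact bot_le
  | succ l ih =>
    obtain ⟨s, hs, hsF, hspan⟩ := ih
    have hst : s ⊆ F (l + 1) := hsF.trans (hF l.le_succ)
    refine ⟨hs.extend hst, hs.linearIndepOn_extend hst, hs.extend_subset hst, fun i hi => ?_⟩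
    rcases Nat.le_succ_iff.1 hi with hi | rfl
    · exact (hspan i hi).trans
        (Submodule.span_mono (Set.inter_subset_inter_left _ (hs.subset_extend hst)))
    · rw [Set.inter_eq_left.2 (hs.extend_subset hst)]
      exact hs.subset_span_extend hst

/-- A finite exhaustive filtration of a vector space has an adapted basis. -/
theorem exists_basis_adapted {k V : Type*} [DivisionRing k] [AddCommGroup V] [Module k V]
    [FiniteDimensional k V] (F : ℕ → Submodule k V) (hF : Monotone F) (h0 : F 0 = ⊥)
    {l : ℕ} (hl : F l = ⊤) :
    ∃ (β : Basis (Fin (finrank k V)) k V) (b : Fin (finrank k V) → ℕ),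
      (∀ i, β i ∈ F (b i + 1)) ∧ ∀ m v, v ∈ F m → ∀ i, m ≤ b i → β.repr v i = 0 := by
  classical
  obtain ⟨s, hs, -, hspan⟩ := exists_linearIndepOn_adapted F hF h0 l
  have hs' : LinearIndependent k ((↑) : s → V) := hs
  have htop : ⊤ ≤ Submodule.span k (Set.range ((↑) : s → V)) := by
    rw [Subtype.range_coe, ← hl]
    exact (hspan l le_rfl).trans (Submodule.span_mono Set.inter_subset_left)
  let β₀ : Basis s k V := Basis.mk hs' htop
  have : Fintype s := FiniteDimensional.fintypeBasisIndex β₀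
  let e : s ≃ Fin (finrank k V) := Fintype.equivFinOfCardEq (finrank_eq_card_basis β₀).symm
  have hex : ∀ v : V, ∃ m, v ∈ F m := fun v => ⟨l, by rw [hl]; trivial⟩
  have hβ : ∀ i, (β₀.reindex e) i = (e.symm i : V) := fun i => by simp [β₀]
  have hne : ∀ i, Nat.find (hex (e.symm i)) ≠ 0 := by
    intro i h
    have := Nat.find_spec (hex (e.symm i))
    rw [h, h0, ← hβ] at this
    exact (β₀.reindex e).ne_zero i this
  refine ⟨β₀.reindex e, fun i => Nat.find (hex (e.symm i)) - 1, fun i => ?_, fun m v hv i hi => ?_⟩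
  · rw [Nat.sub_add_cancel (Nat.one_le_iff_ne_zero.2 (hne i)), hβ]
    exact Nat.find_spec (hex (e.symm i : V))
  · have h1 := hne i
    change m ≤ Nat.find (hex (e.symm i)) - 1 at hi
    have him : ∀ m', m' ≤ m → (e.symm i : V) ∉ F m' := fun m' hm' =>
      Nat.find_min (hex _) (by omega)
    have hv' : v ∈ F (min m l) := by
      rcases min_choice m l with h | h
      · rwa [h]
      · rw [h, hl]; trivial
    have hv2 := hspan _ (min_le_right m l) hv'
    have himg : s ∩ F (min m l) ⊆ β₀ '' {x | (x : V) ∈ F (min m l)} := by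
      rintro x ⟨hx, hx'⟩
      exact ⟨⟨x, hx⟩, hx', by simp [β₀]⟩
    have := β₀.repr_support_subset_of_mem_span _ (Submodule.span_mono himg hv2)
    rw [Basis.repr_reindex_apply]
    by_contra hc
    exact him _ (min_le_left m l) (this (Finsupp.mem_support_iff.2 hc))

/-- The quotient of a representation of a `p`-group in characteristic `p` by a proper
subrepresentation has nonzero invariants. -/
theorem exists_sub_mem_of_isPGroup {p : ℕ} [Fact p.Prime] {k V P : Type*} [Field k] [CharP k p]
    [AddCommGroup V] [Module k V] [Finite V] [Group P] (hP : IsPGroup p P) (ρ : P →* Module.End k V)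
    (W : Submodule k V) (hW : ∀ g, ∀ w ∈ W, ρ g w ∈ W) (hne : W ≠ ⊤) :
    ∃ v ∉ W, ∀ g, ρ g v - v ∈ W := by
  let _ : MulAction P (V ⧸ W) :=
    { smul := fun g => W.mapQ W (ρ g) (hW g)
      one_smul := fun x => by
        induction x using Submodule.Quotient.induction_on with | H v =>
        change W.mapQ W (ρ 1) _ _ = _
        simp
      mul_smul := fun g h x => by
        induction x using Submodule.Quotient.induction_on with | H v =>
        change W.mapQ W (ρ (g * h)) _ _ = W.mapQ W (ρ g) _ (W.mapQ W (ρ h) _ _)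
        simp }
  have hsmul : ∀ (g : P) (v : V), g • (W.mkQ v) = W.mkQ (ρ g v) := fun g v => rfl
  have : Nontrivial (V ⧸ W) := Submodule.Quotient.nontrivial_iff.2 hne
  have : Finite (V ⧸ W) := Finite.of_surjective _ W.mkQ_surjective
  have hdvd : p ∣ Nat.card (V ⧸ W) := by
    obtain ⟨x, hx⟩ := exists_ne (0 : V ⧸ W)
    have hp : addOrderOf x = p := addOrderOf_eq_prime (by
      rw [← Nat.cast_smul_eq_nsmul k, CharP.cast_eq_zero, zero_smul]) hx
    rw [← hp]
    exact addOrderOf_dvd_natCard x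
  obtain ⟨y, hy, hy0⟩ := hP.exists_fixed_point_of_prime_dvd_card_of_fixed_point (V ⧸ W) hdvd
    (a := 0) (fun g => by rw [← map_zero W.mkQ, hsmul, map_zero])
  obtain ⟨v, rfl⟩ := W.mkQ_surjective y
  refine ⟨v, fun hv => hy0 ?_, fun g => ?_⟩
  · rw [eq_comm]
    simpa using hv
  · have := hy g
    rw [hsmul] at this
    rwa [← W.ker_mkQ, LinearMap.mem_ker, map_sub, sub_eq_zero]

/-- The ascending filtration of a representation whose steps are the successive invariants. -/
def invariantsFiltration {k V P : Type*} [Field k] [AddCommGroup V] [Module k V] [Group P]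
    (ρ : P →* Module.End k V) : ℕ → Submodule k V
  | 0 => ⊥
  | l + 1 => ⨅ g, (invariantsFiltration ρ l).comap (ρ g - 1)

section

variable {k V P : Type*} [Field k] [AddCommGroup V] [Module k V] [Group P]
    (ρ : P →* Module.End k V)

theorem mem_invariantsFiltration_succ {l : ℕ} {v : V} :
    v ∈ invariantsFiltration ρ (l + 1) ↔ ∀ g, ρ g v - v ∈ invariantsFiltration ρ l := by
  simp [invariantsFiltration]

theorem map_mem_invariantsFiltration (l : ℕ) (h : P) {v : V}
    (hv : v ∈ invariantsFiltration ρ l) : ρ h v ∈ invariantsFiltration ρ l := by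
  cases l with
  | zero =>
    rw [(Submodule.mem_bot k).1 hv, map_zero]
    exact zero_mem _
  | succ l =>
    rw [mem_invariantsFiltration_succ] at hv ⊢
    intro g
    have := sub_mem (hv (g * h)) (hv h)
    rwa [map_mul, sub_sub_sub_cancel_right] at this

theorem monotone_invariantsFiltration : Monotone (invariantsFiltration ρ) :=
  monotone_nat_of_le_succ fun l _ hv => (mem_invariantsFiltration_succ ρ).2 fun g =>
    sub_mem (map_mem_invariantsFiltration ρ l g hv) hv

theorem commute_map_mem_invariantsFiltration {A : Module.End k V} (hA : ∀ g, ρ g * A = A * ρ g)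
    (l : ℕ) {v : V} (hv : v ∈ invariantsFiltration ρ l) : A v ∈ invariantsFiltration ρ l := by
  induction l generalizing v with
  | zero =>
    rw [(Submodule.mem_bot k).1 hv, map_zero]
    exact zero_mem _
  | succ l ih =>
    rw [mem_invariantsFiltration_succ] at hv ⊢
    intro g
    have h1 : ρ g (A v) = A (ρ g v) := LinearMap.congr_fun (hA g) v
    rw [h1, ← map_sub]
    exact ih (hv g)

theorem exists_invariantsFiltration_eq_top {p : ℕ} [Fact p.Prime] [CharP k p] [Finite V]
    (hP : IsPGroup p P) : ∃ l, invariantsFiltration ρ l = ⊤ := by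
  obtain ⟨l, hl⟩ := monotone_stabilizes_iff_noetherian.2 (inferInstance : IsNoetherian k V)
    ⟨_, monotone_invariantsFiltration ρ⟩
  refine ⟨l, ?_⟩
  by_contra hne
  obtain ⟨v, hv, hg⟩ := exists_sub_mem_of_isPGroup hP ρ _
    (fun g _ hw => map_mem_invariantsFiltration ρ l g hw) hne
  apply hv
  have := hl (l + 1) l.le_succ
  change invariantsFiltration ρ l = invariantsFiltration ρ (l + 1) at this
  rw [this, mem_invariantsFiltration_succ]
  exact hg

end

/-- A matrix commuting with a `p`-group of matrices in characteristic `p` can be made block upper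
triangular in such a way that the `p`-group becomes block upper unitriangular. -/
theorem exists_conj_blockTriangular {p n : ℕ} [Fact p.Prime] {k P : Type*} [Field k] [Finite k]
    [CharP k p] [Group P] (hP : IsPGroup p P) (ρ : P →* Matrix (Fin n) (Fin n) k)
    (A : Matrix (Fin n) (Fin n) k) (hA : ∀ g, ρ g * A = A * ρ g) :
    ∃ (S T : Matrix (Fin n) (Fin n) k) (b : Fin n → ℕ), S * T = 1 ∧ 
      (∀ i j, b j < b i → (S * A * T) i j = 0) ∧
      ∀ g i j, b j ≤ b i → (S * ρ g * T) i j = (1 : Matrix (Fin n) (Fin n) k) i j := by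
  let ρ' : P →* Module.End k (Fin n → k) := (Matrix.toLinAlgEquiv' : _ ≃ₐ[k] _).toMonoidHom.comp ρ
  have hA' : ∀ g, ρ' g * Matrix.toLinAlgEquiv' A = Matrix.toLinAlgEquiv' A * ρ' g := fun g => by
    change Matrix.toLinAlgEquiv' (ρ g) * Matrix.toLinAlgEquiv' A = _ * Matrix.toLinAlgEquiv' (ρ g)
    rw [← map_mul, hA, map_mul]
  obtain ⟨l, hl⟩ := exists_invariantsFiltration_eq_top ρ' hP
  obtain ⟨β, b, hβ, hb⟩ := exists_basis_adapted _ (monotone_invariantsFiltration ρ') rfl hl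
  have hn : finrank k (Fin n → k) = n := by simp
  revert β b
  rw [hn]
  intro β b hβ hb
  let e := Pi.basisFun k (Fin n)
  have hconj : ∀ M : Matrix (Fin n) (Fin n) k, ∀ i j,
      (β.toMatrix e * M * e.toMatrix β) i j = β.repr (Matrix.toLinAlgEquiv' M (β j)) i := by
    intro M i j
    have : M = LinearMap.toMatrix e e (Matrix.toLinAlgEquiv' M) := by
      ext i j
      simp [e]
    conv_lhs => rw [this]
    rw [basis_toMatrix_mul_linearMap_toMatrix_mul_basis_toMatrix, LinearMap.toMatrix_apply]
  refine ⟨β.toMatrix e, e.toMatrix β, b, β.toMatrix_mul_toMatrix_flip e, fun i j hij => ?_,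
    fun g i j hij => ?_⟩
  · rw [hconj]
    exact hb _ _ (commute_map_mem_invariantsFiltration ρ' hA' _ (hβ j)) i hij
  · have := hb _ _ ((mem_invariantsFiltration_succ ρ').1 (hβ j) g) i hij
    rw [map_sub, Finsupp.sub_apply, sub_eq_zero] at this
    rw [hconj]
    refine this.trans ?_
    rw [Basis.repr_self, Matrix.one_apply, Finsupp.single_apply]
    simp [eq_comm]

end

/-- A commutative ring `R` with residue field `k` whose maximal ideal is a one-dimensional
`k`-vector space, identified with `k` through `emb`. -/
structure LengthTwo (R k : Type*) [CommRing R] [Field k] where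
  res : R →+* k
  res_surjective : Function.Surjective res
  emb : k →+ R
  emb_injective : Function.Injective emb
  res_emb : ∀ x, res (emb x) = 0
  exists_emb_eq : ∀ r, res r = 0 → ∃ x, emb x = r
  mul_emb : ∀ r x, r * emb x = emb (res r * x)

namespace LengthTwo

variable {R k : Type*} [CommRing R] [Field k] (L : LengthTwo R k) {m : Type*}

/-- Entrywise application of `LengthTwo.emb`. -/
def embM : Matrix m m k →+ Matrix m m R := L.emb.mapMatrix

theorem embM_apply (X : Matrix m m k) (i j : m) : L.embM X i j = L.emb (X i j) := rfl

theorem embM_injective : Function.Injective (L.embM : Matrix m m k →+ Matrix m m R) := by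
  intro X Y h
  ext i j
  exact L.emb_injective (congrFun (congrFun h i) j)

variable [Fintype m] [DecidableEq m]

theorem mul_embM (G : Matrix m m R) (X : Matrix m m k) :
    G * L.embM X = L.embM (L.res.mapMatrix G * X) := by
  ext i j
  simp [Matrix.mul_apply, embM_apply, L.mul_emb]

theorem embM_mul (X : Matrix m m k) (G : Matrix m m R) :
    L.embM X * G = L.embM (X * L.res.mapMatrix G) := by
  ext i j
  simp only [Matrix.mul_apply, embM_apply, map_sum]
  refine Finset.sum_congr rfl fun l _ => ?_
  rw [mul_comm, L.mul_emb, mul_comm]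
  rfl

theorem res_embM (X : Matrix m m k) : L.res.mapMatrix (L.embM X) = 0 := by
  ext i j
  simp [embM_apply, L.res_emb]

theorem embM_mul_embM (X Y : Matrix m m k) : L.embM X * L.embM Y = 0 := by
  rw [L.mul_embM, L.res_embM, zero_mul, map_zero]

theorem exists_embM_eq (G : Matrix m m R) (hG : L.res.mapMatrix G = 0) :
    ∃ X, L.embM X = G := by
  choose x hx using fun i j => L.exists_emb_eq (G i j) (congrFun (congrFun hG i) j)
  exact ⟨Matrix.of x, by ext i j; exact hx i j⟩

theorem exists_res_mapMatrix_eq (X : Matrix m m k) : ∃ G : Matrix m m R, L.res.mapMatrix G = X := by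
  choose x hx using fun i j => L.res_surjective (X i j)
  exact ⟨Matrix.of x, by ext i j; exact hx i j⟩

/-- Inverse pairs of matrices over the residue field lift. -/
theorem exists_lift_of_mul_eq_one {S T : Matrix m m k} (h : S * T = 1) :
    ∃ S' T' : Matrix m m R, L.res.mapMatrix S' = S ∧ L.res.mapMatrix T' = T ∧ S' * T' = 1 := by
  obtain ⟨S', hS⟩ := L.exists_res_mapMatrix_eq S
  obtain ⟨T', hT⟩ := L.exists_res_mapMatrix_eq T
  obtain ⟨Z, hZ⟩ := L.exists_embM_eq (S' * T' - 1) (by rw [map_sub, map_mul, hS, hT, h, map_one,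
    sub_self])
  refine ⟨S', T' * (1 - L.embM Z), hS, ?_, ?_⟩
  · rw [map_mul, map_sub, map_one, L.res_embM, hT, sub_zero, mul_one]
  · rw [← mul_assoc, eq_add_of_sub_eq' hZ.symm, add_mul, mul_sub, mul_sub, L.embM_mul_embM]
    simp

end LengthTwo

/-- A matrix is strictly block upper triangular with respect to a labelling of the indices. -/
def Matrix.IsStrictBlock {m R : Type*} [Zero R] (b : m → ℕ) (U : Matrix m m R) : Prop :=
  ∀ i j, b j ≤ b i → U i j = 0

namespace Matrix.IsStrictBlock

variable {m R : Type*} [CommRing R] {b : m → ℕ} {U W : Matrix m m R}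

theorem sub (hU : U.IsStrictBlock b) (hW : W.IsStrictBlock b) : (U - W).IsStrictBlock b :=
  fun i j hij => by rw [Matrix.sub_apply, hU i j hij, hW i j hij, sub_zero]

theorem add (hU : U.IsStrictBlock b) (hW : W.IsStrictBlock b) : (U + W).IsStrictBlock b :=
  fun i j hij => by rw [Matrix.add_apply, hU i j hij, hW i j hij, add_zero]

theorem blockTriangular_of_sub_one [DecidableEq m] (hU : (U - 1).IsStrictBlock b) :
    U.BlockTriangular b := by
  intro i j hij
  have h1 : i ≠ j := by
    rintro rfl
    exact lt_irrefl _ hij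
  have := hU i j (le_of_lt hij)
  rwa [Matrix.sub_apply, Matrix.one_apply_ne h1, sub_zero] at this

variable [Fintype m]

theorem mul (hU : U.IsStrictBlock b) (hW : W.IsStrictBlock b) : (U * W).IsStrictBlock b := by
  intro i j hij
  rw [Matrix.mul_apply]
  refine Finset.sum_eq_zero fun l _ => ?_
  rcases le_or_gt (b l) (b i) with h | h
  · rw [hU i l h, zero_mul]
  · rw [hW l j (hij.trans h.le), mul_zero]

theorem blockTriangular_mul {A : Matrix m m R} (hA : A.BlockTriangular b)
    (hW : W.IsStrictBlock b) : (A * W).IsStrictBlock b := by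
  intro i j hij
  rw [Matrix.mul_apply]
  refine Finset.sum_eq_zero fun l _ => ?_
  rcases lt_or_ge (b l) (b i) with h | h
  · rw [hA h, zero_mul]
  · rw [hW l j (hij.trans h), mul_zero]

theorem trace_eq_zero (hU : U.IsStrictBlock b) : U.trace = 0 :=
  Finset.sum_eq_zero fun i _ => hU i i le_rfl

theorem one_sub_mul [DecidableEq m] (hU : (U - 1).IsStrictBlock b) (hW : (W - 1).IsStrictBlock b) :
    (U * W - 1).IsStrictBlock b := by
  have : U * W - 1 = (U - 1) * (W - 1) + (U - 1) + (W - 1) := by noncomm_ring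
  rw [this]
  exact ((hU.mul hW).add hU).add hW

end Matrix.IsStrictBlock

namespace LengthTwo

variable {R k : Type*} [CommRing R] [Field k] (L : LengthTwo R k)

theorem exists_lift_isStrictBlock {m : Type*} [Fintype m] [DecidableEq m] {b : m → ℕ}
    {M : Matrix m m k} (hM : (M - 1).IsStrictBlock b) :
    ∃ W : Matrix m m R, L.res.mapMatrix W = M ∧ (W - 1).IsStrictBlock b := by
  obtain ⟨G, hG⟩ := L.exists_res_mapMatrix_eq (M - 1)
  refine ⟨1 + Matrix.of fun i j => if b j ≤ b i then 0 else G i j, ?_, ?_⟩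
  · rw [map_add, map_one, ← eq_sub_iff_add_eq']
    ext i j
    by_cases h : b j ≤ b i
    · simp [h, hM i j h]
    · rw [← hG]
      simp [h]
  · rw [add_sub_cancel_left]
    intro i j h
    simp [h]

/-- Over a ring of length two, the linear form `X ↦ tr (A X)` on the congruence subgroup extends
to a homomorphism on every `p`-group of matrices whose reduction commutes with `A`. -/
theorem exists_additive_extension_of_isPGroup {p n : ℕ} [Fact p.Prime] [Finite k] [CharP k p]
    {P : Type*} [Group P] (hP : IsPGroup p P) (ρ : P →* Matrix (Fin n) (Fin n) R)
    (A : Matrix (Fin n) (Fin n) k)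
    (hA : ∀ g, L.res.mapMatrix (ρ g) * A = A * L.res.mapMatrix (ρ g)) :
    ∃ f : P → k, (∀ g h, f (g * h) = f g + f h) ∧
      ∀ g X, ρ g = 1 + L.embM X → f g = (A * X).trace := by
  let σ : P →* Matrix (Fin n) (Fin n) k := (L.res.mapMatrix (m := Fin n)).toMonoidHom.comp ρ
  have hσ : ∀ g, L.res.mapMatrix (ρ g) = σ g := fun _ => rfl
  simp only [hσ] at hA
  obtain ⟨S, T, b, hST, hAb, hσb⟩ := exists_conj_blockTriangular hP σ A hA
  have hTS : T * S = 1 := mul_eq_one_comm.1 hST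
  obtain ⟨S', T', hS', hT', hST'⟩ := L.exists_lift_of_mul_eq_one hST
  have hTS' : T' * S' = 1 := mul_eq_one_comm.1 hST'
  have hσ1 : ∀ g, (S * σ g * T - 1).IsStrictBlock b := fun g i j hij => by
    rw [Matrix.sub_apply, hσb g i j hij, sub_self]
  have hσinv : ∀ g, σ g * σ g⁻¹ = 1 := fun g => by rw [← map_mul, mul_inv_cancel, map_one]
  have hσinv' : ∀ g, σ g⁻¹ * σ g = 1 := fun g => by rw [← map_mul, inv_mul_cancel, map_one]
  have hdec : ∀ g, ∃ X W, (W - 1).IsStrictBlock b ∧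
      ρ g = (1 + L.embM X) * (T' * W * S') := by
    intro g
    obtain ⟨W, hW, hWb⟩ := L.exists_lift_isStrictBlock (hσ1 g)
    have hu : L.res.mapMatrix (T' * W * S') = σ g := by
      rw [map_mul, map_mul, hW, hS', hT']
      calc T * (S * σ g * T) * S = (T * S) * σ g * (T * S) := by noncomm_ring
        _ = σ g := by rw [hTS, one_mul, mul_one]
    obtain ⟨Y, hY⟩ := L.exists_embM_eq (ρ g - T' * W * S') (by rw [map_sub, hu, hσ, sub_self])
    refine ⟨Y * σ g⁻¹, W, hWb, ?_⟩
    rw [add_mul, one_mul, L.embM_mul, hu, mul_assoc Y, hσinv', mul_one, hY, add_sub_cancel]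
  have huniq : ∀ g X W Y Z, (W - 1).IsStrictBlock b → (Z - 1).IsStrictBlock b →
      ρ g = (1 + L.embM X) * (T' * W * S') → ρ g = (1 + L.embM Y) * (T' * Z * S') →
      (A * X).trace = (A * Y).trace := by
    intro g X W Y Z hW hZ hX hY
    have hred : ∀ X W, ρ g = (1 + L.embM X) * (T' * W * S') →
        L.res.mapMatrix (T' * W * S') = σ g := by
      intro X W h
      rw [← hσ, h, map_mul _ (1 + _), map_add, map_one, L.res_embM, add_zero, one_mul]
    have hsplit : ∀ X W, ρ g = (1 + L.embM X) * (T' * W * S') →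
        S' * ρ g * T' = L.embM (S * (X * σ g) * T) + W := by
      intro X W h
      conv_lhs => rw [h, add_mul, one_mul, L.embM_mul, hred X W h, mul_add, add_mul, L.mul_embM,
        L.embM_mul, hS', hT']
      rw [add_comm]
      congr 1
      calc S' * (T' * W * S') * T' = (S' * T') * W * (S' * T') := by noncomm_ring
        _ = W := by rw [hST', one_mul, mul_one]
    have hD : (S * ((X - Y) * σ g) * T).IsStrictBlock b := by
      intro i j hij
      apply L.emb_injective
      have h1 : L.embM (S * ((X - Y) * σ g) * T) = (Z - 1) - (W - 1) := by
        have h2 := (hsplit X W hX).symm.trans (hsplit Y Z hY)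
        rw [sub_mul, mul_sub, sub_mul, map_sub, sub_sub_sub_cancel_right, sub_eq_sub_iff_add_eq_add,
          h2, add_comm]
      rw [map_zero, ← L.embM_apply, h1]
      exact (hZ.sub hW) i j hij
    have hAT : (S * A * T).BlockTriangular b := fun i j hij => hAb i j hij
    have := (IsStrictBlock.blockTriangular_mul
      ((hσ1 g⁻¹).blockTriangular_of_sub_one.mul hAT) hD).trace_eq_zero
    rw [← sub_eq_zero, ← trace_sub, ← mul_sub, ← this]
    calc (A * (X - Y)).trace = ((σ g⁻¹ * A) * ((X - Y) * σ g)).trace := by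
          rw [← mul_assoc (σ g⁻¹ * A), trace_mul_comm (_ * _) (σ g), ← mul_assoc, ← mul_assoc,
            hσinv, one_mul]
      _ = (T * (S * (σ g⁻¹ * A) * (T * S) * ((X - Y) * σ g))).trace := by
          rw [hTS, mul_one, mul_assoc S, ← mul_assoc T, hTS, one_mul]
      _ = _ := by
          rw [trace_mul_comm]
          congr 1
          calc S * (σ g⁻¹ * A) * (T * S) * ((X - Y) * σ g) * T
              = S * σ g⁻¹ * 1 * A * T * (S * ((X - Y) * σ g) * T) := by noncomm_ring
            _ = _ := by
              rw [← hTS]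
              noncomm_ring
  choose F w hw hF using hdec
  refine ⟨fun g => (A * F g).trace, fun g h => ?_, fun g X hX => ?_⟩
  · have hred : L.res.mapMatrix (T' * w g * S') = σ g := by
      rw [← hσ, hF g, map_mul _ (1 + _), map_add, map_one, L.res_embM, add_zero, one_mul]
    have hmul : ρ (g * h) =
        (1 + L.embM (F g + σ g * F h * σ g⁻¹)) * (T' * (w g * w h) * S') := by
      have e1 : T' * (w g * w h) * S' = (T' * w g * S') * (T' * w h * S') := by
        calc _ = T' * w g * 1 * w h * S' := by noncomm_ring
          _ = _ := by rw [← hST']; noncomm_ring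
      have e2 : (T' * w g * S') * L.embM (F h) =
          L.embM (σ g * F h * σ g⁻¹) * (T' * w g * S') := by
        rw [L.mul_embM, L.embM_mul, hred, mul_assoc _ (σ g⁻¹), hσinv', mul_one]
      have e3 : (1 + L.embM (F g)) * (1 + L.embM (σ g * F h * σ g⁻¹)) =
          1 + L.embM (F g + σ g * F h * σ g⁻¹) := by
        rw [add_mul, one_mul, mul_add, mul_one, L.embM_mul_embM, map_add]
        abel
      rw [map_mul, hF g, hF h, e1, ← e3]
      calc (1 + L.embM (F g)) * (T' * w g * S') * ((1 + L.embM (F h)) * (T' * w h * S'))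
          = (1 + L.embM (F g)) * (T' * w g * S' + (T' * w g * S') * L.embM (F h)) *
            (T' * w h * S') := by noncomm_ring
        _ = _ := by rw [e2]; noncomm_ring
    change (A * F (g * h)).trace = _
    rw [huniq _ _ _ _ _ (hw (g * h)) ((hw g).one_sub_mul (hw h)) (hF (g * h)) hmul, mul_add,
      trace_add]
    congr 1
    rw [← mul_assoc, ← mul_assoc, ← hA, trace_mul_comm, ← mul_assoc, ← mul_assoc, hσinv', one_mul]
  · refine huniq _ _ _ _ 1 (hw g) (fun i j _ => by rw [sub_self, Matrix.zero_apply]) (hF g) ?_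
    rw [mul_one, hTS', mul_one, hX]

end LengthTwo

/-- The additive group of trace zero matrices. -/
def Matrix.traceZero (n : ℕ) (k : Type*) [Field k] : AddSubgroup (Matrix (Fin n) (Fin n) k) :=
  (Matrix.traceAddMonoidHom (Fin n) k).ker

namespace Matrix.traceZero

variable {n : ℕ} {k : Type*} [Field k]

theorem mem_iff {X : Matrix (Fin n) (Fin n) k} : X ∈ traceZero n k ↔ X.trace = 0 := Iff.rfl

theorem trace_eq_zero (X : traceZero n k) : (X : Matrix (Fin n) (Fin n) k).trace = 0 := X.2

noncomputable instance [Finite k] : Fintype (traceZero n k) := Fintype.ofFinite _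

/-- The conjugation action on trace zero matrices. -/
instance : DistribMulAction (SpecialLinearGroup (Fin n) k) (traceZero n k) where
  smul g X := ⟨g.1 * X.1 * g⁻¹.1, by
    rw [mem_iff, trace_mul_cycle, ← SpecialLinearGroup.coe_mul, inv_mul_cancel,
      SpecialLinearGroup.coe_one, one_mul, trace_eq_zero]⟩
  one_smul X := Subtype.ext <| by
    change (1 : SpecialLinearGroup (Fin n) k).1 * X.1 * (1 : SpecialLinearGroup (Fin n) k)⁻¹.1 = X.1
    simp
  mul_smul g h X := Subtype.ext <| by
    change (g * h).1 * X.1 * (g * h)⁻¹.1 = g.1 * (h.1 * X.1 * h⁻¹.1) * g⁻¹.1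
    rw [_root_.mul_inv_rev, SpecialLinearGroup.coe_mul, SpecialLinearGroup.coe_mul]
    noncomm_ring
  smul_zero g := Subtype.ext <| by
    change g.1 * 0 * g⁻¹.1 = 0
    simp
  smul_add g X Y := Subtype.ext <| by
    change g.1 * (X.1 + Y.1) * g⁻¹.1 = g.1 * X.1 * g⁻¹.1 + g.1 * Y.1 * g⁻¹.1
    noncomm_ring

theorem coe_smul (g : SpecialLinearGroup (Fin n) k) (X : traceZero n k) :
    ((g • X : traceZero n k) : Matrix (Fin n) (Fin n) k) = g.1 * X.1 * g⁻¹.1 := rfl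

theorem coe_smul_mul (g : SpecialLinearGroup (Fin n) k) (X : traceZero n k) :
    ((g • X : traceZero n k) : Matrix (Fin n) (Fin n) k) * g.1 = g.1 * X.1 := by
  rw [coe_smul, mul_assoc, ← SpecialLinearGroup.coe_mul, inv_mul_cancel,
    SpecialLinearGroup.coe_one, mul_one]

theorem trace_smul_mul (g : SpecialLinearGroup (Fin n) k) (A : traceZero n k)
    (X : Matrix (Fin n) (Fin n) k) :
    ((g • A : traceZero n k).1 * X).trace = (A.1 * (g⁻¹.1 * X * g.1)).trace := by
  rw [coe_smul, mul_assoc, mul_assoc, trace_mul_comm, mul_assoc, mul_assoc]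

/-- The trace form is nondegenerate on trace zero matrices when `n` is invertible. -/
theorem exists_trace_mul_ne_zero (hn : (n : k) ≠ 0) {A : traceZero n k} (hA : A ≠ 0) :
    ∃ X : traceZero n k, (A.1 * X.1).trace ≠ 0 := by
  by_contra! h
  refine hA (Subtype.ext (ext_iff_trace_mul_right.2 fun M => ?_))
  have hX : M - (M.trace / n) • (1 : Matrix (Fin n) (Fin n) k) ∈ traceZero n k := by
    rw [mem_iff, trace_sub, trace_smul, trace_one, Fintype.card_fin, smul_eq_mul,
      div_mul_cancel₀ _ hn, sub_self]
  have := h ⟨_, hX⟩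
  rw [mul_sub, Algebra.mul_smul_comm, mul_one, trace_sub, trace_smul, trace_eq_zero A, smul_zero,
    sub_zero] at this
  rw [this]
  simp

/-- Multiplication by a scalar on trace zero matrices. -/
def scale (s : k) (X : traceZero n k) : traceZero n k :=
  ⟨s • X.1, by rw [mem_iff, trace_smul, trace_eq_zero, smul_zero]⟩

/-- The linear form on trace zero matrices attached to a matrix by the trace form. -/
def traceForm (A : traceZero n k) : traceZero n k →+ k where
  toFun X := (A.1 * X.1).trace
  map_zero' := by simp
  map_add' X Y := by simp [mul_add]

theorem natCast_card_ne_zero {p : ℕ} [Fact p.Prime] [Finite k] [CharP k p] {K : Type*} [Field K]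
    (hp : (p : K) ≠ 0) : (Fintype.card (traceZero n k) : K) ≠ 0 := by
  have := Fintype.ofFinite k
  obtain ⟨m, -, hm⟩ := FiniteField.card k p
  have hdvd : Fintype.card (traceZero n k) ∣ p ^ ((m : ℕ) * (n * n)) := by
    rw [← Nat.card_eq_fintype_card]
    refine (AddSubgroup.card_addSubgroup_dvd_card _).trans (dvd_of_eq ?_)
    change Nat.card (Fin n → Fin n → k) = _
    simp [hm, pow_mul]
  obtain ⟨c, hc⟩ := hdvd
  intro h
  apply pow_ne_zero ((m : ℕ) * (n * n)) hp
  rw [← Nat.cast_pow, hc, Nat.cast_mul, h, zero_mul]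

/-- The pairing `(A, X) ↦ ψ (tr (A X))` on trace zero matrices. -/
def pairing {p : ℕ} [Fact p.Prime] [Finite k] [CharP k p] {K : Type*} [Field K]
    (hp : (p : K) ≠ 0) (hn : (n : k) ≠ 0) {ψ : AddChar k K} (hψ : ψ.IsPrimitive) :
    InvariantPairing K (SpecialLinearGroup (Fin n) k) (traceZero n k) where
  toFun A X := ψ (A.1 * X.1).trace
  zero_right A := by simp
  add_right A X Y := by
    rw [AddSubgroup.coe_add, mul_add, trace_add, ψ.map_add_eq_mul]
  symm A X := by rw [trace_mul_comm]
  smul_smul q A X := by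
    rw [trace_smul_mul, coe_smul]
    congr 3
    calc q⁻¹.1 * (q.1 * X.1 * q⁻¹.1) * q.1 = (q⁻¹.1 * q.1) * X.1 * (q⁻¹.1 * q.1) := by noncomm_ring
      _ = X.1 := by
        rw [← SpecialLinearGroup.coe_mul, inv_mul_cancel, SpecialLinearGroup.coe_one, one_mul,
          mul_one]
  sum_eq_zero A hA := by
    refine AddChar.sum_eq_zero_of_ne_one (ψ := ψ.compAddMonoidHom (traceForm A)) ?_
    obtain ⟨X, hX⟩ := exists_trace_mul_ne_zero hn hA
    obtain ⟨s, hs⟩ := AddChar.ne_one_iff.1 (hψ hX)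
    refine AddChar.ne_one_iff.2 ⟨scale s X, ?_⟩
    rwa [AddChar.mulShift_apply, mul_comm, ← smul_eq_mul, ← trace_smul,
      ← Algebra.mul_smul_comm] at hs
  card_ne_zero := natCast_card_ne_zero hp

end Matrix.traceZero

/-- A finite field has a primitive additive character with values in any algebraically closed
field of a different characteristic. -/
theorem AddChar.exists_isPrimitive_of_isAlgClosed (k K : Type*) [Field k] [Finite k] [Field K]
    [IsAlgClosed K] (h : ringChar K ≠ ringChar k) : ∃ ψ : AddChar k K, ψ.IsPrimitive := by
  let φ := AddChar.FiniteField.primitiveChar k K h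
  have := φ.n.ne_zero
  have : NeZero (φ.n : ℕ) := ⟨this⟩
  have : FiniteDimensional K (CyclotomicField φ.n K) :=
    inferInstanceAs (FiniteDimensional K (Polynomial.cyclotomic φ.n K).SplittingField)
  let ι : CyclotomicField φ.n K →+* K :=
    (IsAlgClosed.lift : CyclotomicField φ.n K →ₐ[K] K).toRingHom
  exact ⟨_, φ.prim.compMulHom_of_isPrimitive (f := (ι : CyclotomicField φ.n K →* K)) ι.injective⟩

namespace LengthTwo

variable {R k : Type*} [CommRing R] [Field k] (L : LengthTwo R k) {n : ℕ}

theorem det_one_add_embM (X : Matrix (Fin n) (Fin n) k) :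
    (1 + L.embM X).det = 1 + L.emb X.trace := by
  obtain ⟨G, hG⟩ := L.exists_res_mapMatrix_eq X
  have h1 : L.embM X = L.emb 1 • G := by
    ext i j
    rw [Matrix.smul_apply, smul_eq_mul, mul_comm, L.mul_emb, mul_one, ← hG]
    rfl
  have h2 : L.emb 1 ^ 2 = 0 := by rw [pow_two, L.mul_emb, L.res_emb, zero_mul, map_zero]
  rw [h1, det_one_add_smul, h2, mul_zero, add_zero, L.mul_emb, mul_one, ← hG]
  congr 2
  simp [trace]

/-- The embedding of trace zero matrices as the congruence subgroup. -/
def incl (X : traceZero n k) : SpecialLinearGroup (Fin n) R :=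
  ⟨1 + L.embM X.1, by rw [L.det_one_add_embM, traceZero.trace_eq_zero, map_zero, add_zero]⟩

theorem incl_val (X : traceZero n k) : (L.incl X).1 = 1 + L.embM X.1 := rfl

theorem incl_add (X Y : traceZero n k) : L.incl (X + Y) = L.incl X * L.incl Y := by
  apply Subtype.ext
  change (L.incl (X + Y)).1 = (L.incl X).1 * (L.incl Y).1
  rw [incl_val, incl_val, incl_val, add_mul, one_mul, mul_add, mul_one,
    L.embM_mul_embM, AddSubgroup.coe_add, map_add]
  abel

theorem incl_nsmul (m : ℕ) (X : traceZero n k) : L.incl (m • X) = L.incl X ^ m := by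
  induction m with
  | zero =>
    rw [zero_smul, pow_zero]
    exact Subtype.ext (by rw [incl_val, AddSubgroup.coe_zero, map_zero, add_zero]; rfl)
  | succ m ih => rw [succ_nsmul, incl_add, ih, pow_succ]

theorem incl_injective : Function.Injective (L.incl : traceZero n k → _) := fun _ _ h =>
  Subtype.ext (L.embM_injective (add_left_cancel (congrArg Subtype.val h)))

/-- The reduction map on special linear groups. -/
def proj (n : ℕ) : SpecialLinearGroup (Fin n) R →* SpecialLinearGroup (Fin n) k :=
  SpecialLinearGroup.map L.res

theorem proj_val (g : SpecialLinearGroup (Fin n) R) :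
    (L.proj n g).1 = L.res.mapMatrix g.1 := rfl

theorem proj_incl (X : traceZero n k) : L.proj n (L.incl X) = 1 := by
  apply Subtype.ext
  rw [proj_val, incl_val, map_add, map_one, L.res_embM, add_zero]
  rfl

theorem exists_incl_eq (g : SpecialLinearGroup (Fin n) R) (hg : L.proj n g = 1) :
    ∃ X, L.incl X = g := by
  have h1 : L.res.mapMatrix g.1 = 1 := congrArg Subtype.val hg
  obtain ⟨X, hX⟩ := L.exists_embM_eq (g.1 - 1) (by rw [map_sub, h1, map_one, sub_self])
  have h2 : g.1 = 1 + L.embM X := by rw [hX, add_sub_cancel]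
  have h3 : L.emb X.trace = 0 := by
    have := L.det_one_add_embM X
    rwa [← h2, g.2, left_eq_add] at this
  refine ⟨⟨X, L.emb_injective (h3.trans L.emb.map_zero.symm)⟩, Subtype.ext h2.symm⟩

theorem mul_incl (g : SpecialLinearGroup (Fin n) R) (X : traceZero n k) :
    g * L.incl X = L.incl (L.proj n g • X) * g := by
  apply Subtype.ext
  change g.1 * (L.incl X).1 = (L.incl (L.proj n g • X)).1 * g.1
  rw [incl_val, incl_val, mul_add, add_mul,
    one_mul, mul_one, L.mul_embM, L.embM_mul, ← proj_val, traceZero.coe_smul_mul]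

theorem proj_surjective (hn : n ≠ 0) : Function.Surjective (L.proj n) := by
  intro q
  obtain ⟨G, hG⟩ := L.exists_res_mapMatrix_eq q.1
  obtain ⟨y, hy⟩ := L.exists_emb_eq (G.det - 1) (by
    rw [map_sub, RingHom.map_det, hG, q.2, map_one, sub_self])
  let i : Fin n := ⟨0, Nat.pos_of_ne_zero hn⟩
  refine ⟨⟨(1 + L.embM (single i i (-y))) * G, ?_⟩, Subtype.ext ?_⟩
  · rw [det_mul, L.det_one_add_embM, trace_single_eq_same, eq_add_of_sub_eq' hy.symm, add_mul,
      one_mul, mul_add, mul_one, L.mul_emb, L.res_emb, zero_mul, map_zero, map_neg]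
    ring
  · change L.res.mapMatrix ((1 + L.embM (single i i (-y))) * G) = q.1
    rw [map_mul, map_add, map_one, L.res_embM, add_zero, one_mul, hG]

/-- The pairing with values `ψ (tr (A X))` extends from the congruence subgroup to a cocycle on
the action groupoid of the special linear group. -/
theorem exists_cocycle {p : ℕ} [Fact p.Prime] [Finite R] [Finite k] [CharP k p] {K : Type*}
    [Field K] (ψ : AddChar k K) (n : ℕ) :
    ∃ θ : SpecialLinearGroup (Fin n) R → traceZero n k → Kˣ,
      (∀ g h A, θ (g * h) A = θ g (L.proj n h • A) * θ h A) ∧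
      ∀ X A, (θ (L.incl X) A : K) = ψ (A.1 * X.1).trace := by
  classical
  let _ : MulAction (SpecialLinearGroup (Fin n) R) (traceZero n k) :=
    MulAction.compHom _ (L.proj n)
  have hsmul : ∀ (g : SpecialLinearGroup (Fin n) R) (A : traceZero n k), g • A = L.proj n g • A :=
    fun _ _ => rfl
  let Ψ : Multiplicative k →* Kˣ := ψ.toMonoidHom.toHomUnits
  have hΨ : ∀ x : k, (Ψ (Multiplicative.ofAdd x) : K) = ψ x := fun _ => rfl
  have hΨp : ∀ x : k, Ψ (Multiplicative.ofAdd x) ^ p = 1 := fun x => by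
    rw [← map_pow, ← ofAdd_nsmul, nsmul_eq_mul, CharP.cast_eq_zero, zero_mul, ofAdd_zero, map_one]
  have hlog : ∀ g : SpecialLinearGroup (Fin n) R, ∃ X, L.proj n g = 1 → L.incl X = g := by
    intro g
    by_cases hg : L.proj n g = 1
    · obtain ⟨X, hX⟩ := L.exists_incl_eq g hg
      exact ⟨X, fun _ => hX⟩
    · exact ⟨0, fun h => absurd h hg⟩
  choose ℓ hℓ using hlog
  let χ : traceZero n k → SpecialLinearGroup (Fin n) R → Kˣ :=
    fun A g => Ψ (Multiplicative.ofAdd (A.1 * (ℓ g).1).trace)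
  have hχX : ∀ A X, χ A (L.incl X) = Ψ (Multiplicative.ofAdd (A.1 * X.1).trace) := fun A X => by
    simp only [χ, L.incl_injective (hℓ _ (L.proj_incl X))]
  have hχ : ∀ g A, ∀ m ∈ (L.proj n).ker, χ (g • A) m = χ A (g⁻¹ * m * g) := by
    intro g A m hm
    obtain ⟨X, rfl⟩ := L.exists_incl_eq m hm
    rw [← inv_inv g, inv_inv g⁻¹, L.mul_incl, mul_inv_cancel_right, hχX, hχX, inv_inv, hsmul,
      traceZero.trace_smul_mul, traceZero.coe_smul, map_inv, inv_inv]
  have hNp : IsPGroup p (L.proj n).ker := by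
    rintro ⟨m, hm⟩
    obtain ⟨X, rfl⟩ := L.exists_incl_eq m hm
    refine ⟨1, Subtype.ext ?_⟩
    rw [Subgroup.coe_pow, pow_one, ← L.incl_nsmul]
    have : p • X = 0 := Subtype.ext (by
      rw [AddSubgroup.coe_nsmul, ← Nat.cast_smul_eq_nsmul k, CharP.cast_eq_zero, zero_smul]; rfl)
    rw [this, ← zero_smul ℕ (0 : traceZero n k), L.incl_nsmul, pow_zero]
    rfl
  have hfin : Finite (SpecialLinearGroup (Fin n) R) := Subtype.finite
  obtain ⟨θ, hθ, hθχ⟩ := exists_cocycle_of_stabilizer_hom (L.proj n).ker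
    (fun m hm A => by rw [hsmul, MonoidHom.mem_ker.1 hm, one_smul]) χ hχ (fun A => by
      obtain ⟨f, hf⟩ := exists_extension_of_isPGroup (p := p)
        ((L.proj n).ker.subgroupOf (MulAction.stabilizer _ A))
        (hNp.comap_of_injective _ (Subgroup.subtype_injective _))
        (fun g => χ A g) (fun g m hm => by
          have := hχ g A m hm
          rw [MulAction.mem_stabilizer_iff.1 g.2] at this
          exact this.symm)
        (fun m _ => hΨp _) (fun P hP _ => by
          let ρ : P →* Matrix (Fin n) (Fin n) R :=
            { toFun := fun g => g.1.1.1
              map_one' := rfl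
              map_mul' := fun _ _ => rfl }
          obtain ⟨f, hf, hfX⟩ := L.exists_additive_extension_of_isPGroup hP ρ A.1 (fun g => by
            have h := traceZero.coe_smul_mul (L.proj n g.1.1) A
            rw [← hsmul, MulAction.mem_stabilizer_iff.1 g.1.2] at h
            exact h.symm)
          refine ⟨Ψ.comp (MonoidHom.mk' (fun g => Multiplicative.ofAdd (f g)) fun g h => ?_),
            fun m hm => ?_⟩
          · rw [hf, ofAdd_add]
          · obtain ⟨X, hX⟩ := L.exists_incl_eq m.1.1 hm
            change Ψ (Multiplicative.ofAdd (f m)) = χ A m.1.1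
            rw [← hX, hχX, hfX m X.1 (congrArg Subtype.val hX.symm)])
      exact ⟨f, fun m hm => hf m hm⟩)
  exact ⟨θ, hθ, fun X A => by rw [hθχ _ (L.proj_incl X), hχX, hΨ]⟩

/-- The special linear group over a ring of length two is an extension carrying a cocycle. -/
theorem nonempty_splitExtension (L : LengthTwo R k) {p : ℕ} [Fact p.Prime] [Finite R] [Finite k] [CharP k p]
    {K : Type*} [Field K] (hp : (p : K) ≠ 0) (hn : (n : k) ≠ 0) {ψ : AddChar k K}
    (hψ : ψ.IsPrimitive) :
    Nonempty (SplitExtension (traceZero.pairing hp hn hψ) (SpecialLinearGroup (Fin n) R)) := by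
  obtain ⟨θ, hθ, hθX⟩ := L.exists_cocycle (p := p) ψ n
  exact ⟨{
    proj := L.proj n
    proj_surjective := L.proj_surjective (by rintro rfl; exact hn Nat.cast_zero)
    incl := L.incl
    incl_add := L.incl_add
    proj_incl := L.proj_incl
    exists_incl_eq := L.exists_incl_eq
    mul_incl := L.mul_incl
    cocycle := θ
    cocycle_mul := hθ
    cocycle_incl := hθX }⟩

/-- The dual numbers over a field. -/
def dualNumber (k : Type*) [Field k] : LengthTwo (DualNumber k) k where
  res := TrivSqZeroExt.fstHom k k k
  res_surjective x := ⟨TrivSqZeroExt.inl x, rfl⟩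
  emb := TrivSqZeroExt.inrHom k k
  emb_injective := TrivSqZeroExt.inr_injective
  res_emb _ := rfl
  exists_emb_eq r hr := ⟨r.snd, TrivSqZeroExt.ext hr.symm rfl⟩
  mul_emb r x := by ext <;> simp [mul_comm]

end LengthTwo

namespace TruncatedWittVector

open WittVector

variable (p : ℕ) [Fact p.Prime] {k : Type*} [Field k]

theorem ext_of_coeff_zero_one {p : ℕ} {k : Type*} {x y : TruncatedWittVector p 2 k}
    (h0 : x.coeff 0 = y.coeff 0) (h1 : x.coeff 1 = y.coeff 1) : x = y :=
  TruncatedWittVector.ext (Fin.forall_fin_two.2 ⟨h0, h1⟩)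

theorem coeff_zero_truncate_two (x : WittVector p k) :
    (WittVector.truncate 2 x).coeff 0 = x.coeff 0 := WittVector.coeff_truncate x 0

theorem coeff_one_truncate_two (x : WittVector p k) :
    (WittVector.truncate 2 x).coeff 1 = x.coeff 1 := WittVector.coeff_truncate x 1

theorem coeff_one_verschiebung (x : WittVector p k) :
    (verschiebung x).coeff 1 = x.coeff 0 := verschiebung_coeff_add_one x 0

/-- The reduction of Witt vectors of length two. -/
noncomputable def reduction (k : Type*) [Field k] : TruncatedWittVector p 2 k →+* k where
  toFun := coeff 0
  map_one' := by
    rw [← map_one (WittVector.truncate 2), coeff_zero_truncate_two, one_coeff_zero]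
  map_zero' := TruncatedWittVector.coeff_zero p 2 k 0
  map_mul' x y := by
    obtain ⟨x, rfl⟩ := WittVector.truncate_surjective p 2 k x
    obtain ⟨y, rfl⟩ := WittVector.truncate_surjective p 2 k y
    rw [← map_mul]
    simp only [coeff_zero_truncate_two, mul_coeff_zero]
  map_add' x y := by
    obtain ⟨x, rfl⟩ := WittVector.truncate_surjective p 2 k x
    obtain ⟨y, rfl⟩ := WittVector.truncate_surjective p 2 k y
    rw [← map_add]
    simp only [coeff_zero_truncate_two, add_coeff_zero]

/-- The additive map sending `x` to the Witt vector `(0, x ^ p)`. -/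
noncomputable def embedding (k : Type*) [Field k] [CharP k p] :
    k →+ TruncatedWittVector p 2 k where
  toFun x := WittVector.truncate 2 (verschiebung (WittVector.mk p fun _ => x ^ p))
  map_zero' := by
    apply ext_of_coeff_zero_one
    · rw [coeff_zero_truncate_two, verschiebung_coeff_zero, TruncatedWittVector.coeff_zero]
    · rw [coeff_one_truncate_two, coeff_one_verschiebung,
        TruncatedWittVector.coeff_zero, WittVector.coeff_mk]
      exact zero_pow (Fact.out : p.Prime).ne_zero
  map_add' x y := by
    rw [← map_add, ← map_add]
    apply ext_of_coeff_zero_one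
    · rw [coeff_zero_truncate_two, coeff_zero_truncate_two, verschiebung_coeff_zero,
        verschiebung_coeff_zero]
    · rw [coeff_one_truncate_two, coeff_one_truncate_two,
        coeff_one_verschiebung, coeff_one_verschiebung, add_coeff_zero, WittVector.coeff_mk,
        WittVector.coeff_mk, WittVector.coeff_mk, add_pow_char]

variable [CharP k p]

theorem embedding_apply (x : k) : embedding p k x =
    WittVector.truncate 2 (verschiebung (WittVector.mk p fun _ => x ^ p)) := rfl

theorem coeff_zero_embedding (x : k) : (embedding p k x).coeff 0 = 0 := by
  rw [embedding_apply, coeff_zero_truncate_two, verschiebung_coeff_zero]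

theorem coeff_one_embedding (x : k) : (embedding p k x).coeff 1 = x ^ p := by
  rw [embedding_apply, coeff_one_truncate_two, coeff_one_verschiebung, WittVector.coeff_mk]

theorem mul_embedding (r : TruncatedWittVector p 2 k) (x : k) :
    r * embedding p k x = embedding p k (r.coeff 0 * x) := by
  obtain ⟨r, rfl⟩ := WittVector.truncate_surjective p 2 k r
  have h : WittVector.truncate 2 r * embedding p k x = WittVector.truncate 2
      (verschiebung ((WittVector.mk p fun _ => x ^ p) * WittVector.frobenius r)) := by
    rw [verschiebung_mul_frobenius, mul_comm, map_mul, embedding_apply]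
  rw [h]
  apply ext_of_coeff_zero_one
  · rw [coeff_zero_truncate_two, coeff_zero_embedding, verschiebung_coeff_zero]
  · rw [coeff_one_truncate_two, coeff_one_embedding, coeff_one_verschiebung,
      mul_coeff_zero, WittVector.coeff_mk, coeff_frobenius_charP, coeff_zero_truncate_two, mul_comm, mul_pow]

end TruncatedWittVector

/-- The truncated Witt vectors of length two over a finite field. -/
noncomputable def LengthTwo.wittVector (p : ℕ) [Fact p.Prime] (k : Type*) [Field k] [Finite k]
    [CharP k p] : LengthTwo (TruncatedWittVector p 2 k) k where
  res := TruncatedWittVector.reduction p k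
  res_surjective x := ⟨TruncatedWittVector.mk p fun _ => x,
    TruncatedWittVector.coeff_mk (p := p) (n := 2) (fun _ => x) 0⟩
  emb := TruncatedWittVector.embedding p k
  emb_injective x y h := by
    have h1 := congrArg (TruncatedWittVector.coeff 1) h
    rw [TruncatedWittVector.coeff_one_embedding, TruncatedWittVector.coeff_one_embedding] at h1
    exact frobenius_inj k p h1
  res_emb := TruncatedWittVector.coeff_zero_embedding p
  exists_emb_eq r hr := by
    have : ExpChar k p := ExpChar.prime Fact.out
    obtain ⟨x, hx⟩ := surjective_frobenius k p (TruncatedWittVector.coeff 1 r)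
    refine ⟨x, TruncatedWittVector.ext_of_coeff_zero_one ?_ ?_⟩
    · rw [TruncatedWittVector.coeff_zero_embedding]
      exact hr.symm
    · rw [TruncatedWittVector.coeff_one_embedding]
      exact hx
  mul_emb := TruncatedWittVector.mul_embedding p

/-- **Theorem 5.4 for `SLₙ`.** For `q = p ^ d` with `p ∤ n` and `K` algebraically closed
with `char K ≠ p`, the group algebras `K[SLₙ(𝔽_q[t]/t²)]` and `K[SLₙ(W₂(𝔽_q))]` are
isomorphic as `K`-algebras. -/
theorem group_algebra_iso_SL_dualNumber_wittVector
    (p d n : ℕ) [Fact p.Prime] (hd : 1 ≤ d) (hn : 1 ≤ n) (hpn : ¬ p ∣ n)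
    (q : ℕ) (hq : q = p ^ d)
    (K : Type*) [Field K] [IsAlgClosed K] (hK : ringChar K ≠ p) :
    Nonempty
      (MonoidAlgebra K (Matrix.SpecialLinearGroup (Fin n) (DualNumber (GaloisField p d))) ≃ₐ[K]
       MonoidAlgebra K
         (Matrix.SpecialLinearGroup (Fin n) (TruncatedWittVector p 2 (GaloisField p d)))) := by
  have hk : ringChar (GaloisField p d) = p := ringChar.eq_iff.2 inferInstance
  obtain ⟨ψ, hψ⟩ := AddChar.exists_isPrimitive_of_isAlgClosed (GaloisField p d) K (by rwa [hk])
  have hpK : (p : K) ≠ 0 := fun h => by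
    rcases (Nat.dvd_prime Fact.out).1 (ringChar.dvd h) with h1 | h1
    · exact CharP.ringChar_ne_one h1
    · exact hK h1
  have hnk : (n : GaloisField p d) ≠ 0 := by
    rwa [Ne, CharP.cast_eq_zero_iff (GaloisField p d) p]
  have : Finite (DualNumber (GaloisField p d)) :=
    inferInstanceAs (Finite (GaloisField p d × GaloisField p d))
  have : Finite (TruncatedWittVector p 2 (GaloisField p d)) :=
    inferInstanceAs (Finite (Fin 2 → GaloisField p d))
  obtain ⟨X⟩ := (LengthTwo.dualNumber (GaloisField p d)).nonempty_splitExtension hpK hnk hψ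
  obtain ⟨Y⟩ := (LengthTwo.wittVector p (GaloisField p d)).nonempty_splitExtension hpK hnk hψ
  exact ⟨X.algEquiv Y⟩
end
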